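/- arXiv:2206.06492 — 2 statements merged into one kernel-verified Lean document; each statement's English description precedes it below -/
import Mathlib

section
/- For each S_⋆ ∈ {S, S_m, S_s}, both S_⋆ and its subset S'_⋆ of strategic measures induced by nonrandomized policies are analytic subsets of P(Ω); moreover, if the constraint graph Γ is a Borel subset of 𝕏 × 𝔸, then S_⋆ and S'_⋆ are Borel subsets of P(Ω). -/
open MeasureTheory ProbabilityTheory Filter
open scoped ENNReal NNReal Topology

noncomputable section

namespace PaperStmt

/-- The Borel σ-algebra of the topology of weak convergence on the space of Borel
probability measures. -/
instance instMeasProb {Ω : Type*} [MeasurableSpace Ω] [TopologicalSpace Ω]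
    [OpensMeasurableSpace Ω] : MeasurableSpace (ProbabilityMeasure Ω) := borel _

/-- A set is universally measurable if it is measurable with respect to the completion of
every Borel probability measure. -/
def UniversallyMeasurableSet {α : Type*} [MeasurableSpace α] (s : Set α) : Prop :=
  ∀ μ : Measure α, IsProbabilityMeasure μ → NullMeasurableSet s μ

/-- A map between measurable spaces is universally measurable if preimages of measurable
sets are universally measurable. -/
def UniversallyMeasurable {α β : Type*} [MeasurableSpace α] [MeasurableSpace β]
    (f : α → β) : Prop :=
  ∀ s : Set β, MeasurableSet s → UniversallyMeasurableSet (f ⁻¹' s)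

/-- A function into the extended reals is lower semianalytic if all its sublevel sets are
analytic. -/
def LowerSemianalytic {γ : Type*} [TopologicalSpace γ] (f : γ → EReal) : Prop :=
  ∀ r : ℝ, MeasureTheory.AnalyticSet {x | f x ≤ (r : EReal)}

/-- Lower semianalyticity on a given (analytic) domain. -/
def LowerSemianalyticOn {γ : Type*} [TopologicalSpace γ] (D : Set γ) (f : γ → EReal) : Prop :=
  ∀ r : ℝ, MeasureTheory.AnalyticSet {x | x ∈ D ∧ f x ≤ (r : EReal)}

/-- Upper semianalyticity on a given (analytic) domain. -/
def UpperSemianalyticOn {γ : Type*} [TopologicalSpace γ] (D : Set γ) (f : γ → EReal) : Prop :=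
  ∀ r : ℝ, MeasureTheory.AnalyticSet {x | x ∈ D ∧ (r : EReal) ≤ f x}

/-- The nonnegative part of an extended real number, as an element of `ℝ≥0∞`. -/
def ePos (y : EReal) : ℝ≥0∞ := if y = ⊤ then ⊤ else ENNReal.ofReal y.toReal

/-- The integral `∫ f⁺ dμ - ∫ f⁻ dμ` of an extended-real-valued function, with the
convention `∞ - ∞ = ∞`. -/
def eint {γ : Type*} [MeasurableSpace γ] (μ : Measure γ) (f : γ → EReal) : EReal :=
  if (∫⁻ x, ePos (f x) ∂μ) = ⊤ then ⊤
  else ((∫⁻ x, ePos (f x) ∂μ : ℝ≥0∞) : EReal) - ((∫⁻ x, ePos (-f x) ∂μ : ℝ≥0∞) : EReal)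

/-- Finite sums of extended reals, with the convention `∞ - ∞ = ∞`. -/
def esum {n : ℕ} (v : Fin n → EReal) : EReal :=
  if (∑ i, ePos (v i)) = ⊤ then ⊤
  else ((∑ i, ePos (v i) : ℝ≥0∞) : EReal) - ((∑ i, ePos (-v i) : ℝ≥0∞) : EReal)

/-- The space `H_n = (𝕏 × 𝔸)ⁿ × 𝕏` of histories `h_n = (x_0,a_0,…,x_n)`. -/
abbrev Hist (X A : Type*) (n : ℕ) := (Fin n → X × A) × X

/-- The sample space `Ω = (𝕏 × 𝔸)^∞`. -/
abbrev Traj (X A : Type*) := ℕ → X × A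

/-- The initial state `x_0` of a history. -/
def firstState {X A : Type*} : ∀ {n : ℕ}, Hist X A n → X
  | 0, h => h.2
  | _ + 1, h => (h.1 0).1

/-- A universally measurable policy for the MDP with control constraint `Acts`. -/
structure Policy {X A : Type*} [MeasurableSpace X] [MeasurableSpace A]
    (Acts : X → Set A) where
  μ : ∀ n : ℕ, Hist X A n → Measure A
  isProb : ∀ n h, IsProbabilityMeasure (μ n h)
  umeas : ∀ (n : ℕ) (B : Set A), MeasurableSet B →
    UniversallyMeasurable fun h : Hist X A n => μ n h B
  feasible : ∀ n h, μ n h (Acts h.2) = 1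

namespace Policy

variable {X A : Type*} [MeasurableSpace X] [MeasurableSpace A] {Acts : X → Set A}

/-- Nonrandomized policies: every decision is a Dirac measure. -/
def Nonrandomized (π : Policy Acts) : Prop :=
  ∀ n h, ∃ a : A, π.μ n h = Measure.dirac a

/-- Markov policies: the decision depends only on the current state. -/
def Markov (π : Policy Acts) : Prop :=
  ∃ m : ℕ → X → Measure A, ∀ n h, π.μ n h = m n h.2

/-- Stationary policies. -/
def Stationary (π : Policy Acts) : Prop :=
  ∃ m : X → Measure A, ∀ n h, π.μ n h = m h.2

/-- Semi-Markov policies: the decision depends only on `(x_0, x_n)`. -/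
def SemiMarkov (π : Policy Acts) : Prop :=
  ∃ m : ℕ → X × X → Measure A, ∀ n h, π.μ n h = m n (firstState h, h.2)

/-- Semi-stationary policies. -/
def SemiStationary (π : Policy Acts) : Prop :=
  ∃ m : X × X → Measure A, ∀ n h, π.μ n h = m (firstState h, h.2)

end Policy

variable {X A : Type*} [MeasurableSpace X] [MeasurableSpace A]

/-- The iterated integral giving the finite-dimensional distributions of the process
induced by an initial distribution, the transition kernel and a policy. -/
def histInt (p0 : Measure X) (q : Kernel (X × A) X)
    (ν : ∀ n : ℕ, Hist X A n → Measure A) :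
    ∀ n : ℕ, (Hist X A n → ℝ≥0∞) → ℝ≥0∞
  | 0, f => ∫⁻ x, f (Fin.elim0, x) ∂p0
  | n + 1, f => histInt p0 q ν n fun h =>
      ∫⁻ a, ∫⁻ y, f (Fin.snoc h.1 (h.2, a), y) ∂(q (h.2, a)) ∂(ν n h)

/-- `Induces q π p0 p` says that `p` is (the restriction to the Borel σ-algebra of) the
strategic measure `ρ_{p0}[π]`, i.e. `p` has the finite-dimensional distributions generated
by `p0`, the policy `π`, and the transition kernel `q`. -/
def Induces (q : Kernel (X × A) X) {Acts : X → Set A} (π : Policy Acts)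
    (p0 : Measure X) (p : Measure (Traj X A)) : Prop :=
  ∀ (n : ℕ) (B : Set (Hist X A n)), MeasurableSet B →
    p {ω : Traj X A | ((fun i : Fin n => ω i.val), (ω n).1) ∈ B}
      = histInt p0 q π.μ n (B.indicator fun _ => 1)

/-- The set of strategic measures induced by policies in the class `C` (over all initial
distributions). -/
def SOf (q : Kernel (X × A) X) (Acts : X → Set A) (C : Policy Acts → Prop) :
    Set (ProbabilityMeasure (Traj X A)) :=
  {p | ∃ (π : Policy Acts) (p0 : ProbabilityMeasure X),
    C π ∧ Induces q π p0.toMeasure p.toMeasure}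

variable [TopologicalSpace X] [BorelSpace X] [TopologicalSpace A] [BorelSpace A]

/-- The section `tilde-S_⋆(x)`: strategic measures in the class with initial distribution `δ_x`. -/
def tsec (q : Kernel (X × A) X) (Acts : X → Set A) (C : Policy Acts → Prop) (x : X) :
    Set (ProbabilityMeasure (Traj X A)) :=
  {p | p ∈ SOf q Acts C ∧ p.toMeasure.map (fun ω => (ω 0).1) = Measure.dirac x}

/-- The set `tilde-S_⋆ ⊂ 𝕏 × P(Ω)`. -/
def tset (q : Kernel (X × A) X) (Acts : X → Set A) (C : Policy Acts → Prop) :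
    Set (X × ProbabilityMeasure (Traj X A)) :=
  {xp | xp.2 ∈ tsec q Acts C xp.1}

end PaperStmt

namespace PaperStmt

/-- Inner regularity: the range of a continuous map from the Baire space contains compact sets
of nearly full outer measure. -/
lemma exists_isCompact_image_measure_gt {α : Type*} [TopologicalSpace α] [PolishSpace α]
    [MeasurableSpace α] [BorelSpace α] (μ : Measure α) [IsFiniteMeasure μ]
    {f : (ℕ → ℕ) → α} (hf : Continuous f) {c : ℝ≥0∞} (hc : c < μ (Set.range f)) :
    ∃ K ⊆ Set.range f, IsCompact K ∧ c ≤ μ K := by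
  have step : ∀ (k : ℕ) (C : {C : Set (ℕ → ℕ) // c < μ (f '' C)}),
      ∃ n : ℕ, c < μ (f '' (C.1 ∩ {y | y k ≤ n})) := by
    rintro k ⟨C, hC⟩
    have hU : f '' C = ⋃ n : ℕ, f '' (C ∩ {y | y k ≤ n}) := by
      rw [← Set.image_iUnion, ← Set.inter_iUnion]
      congr 1
      refine (Set.inter_eq_left.2 fun y _ => Set.mem_iUnion.2 ⟨y k, ?_⟩).symm
      exact le_rfl (a := y k)
    have hm : Monotone fun n : ℕ => f '' (C ∩ {y | y k ≤ n}) := fun n m hnm =>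
      Set.image_mono (Set.inter_subset_inter_right _ fun y (hy : y k ≤ n) => hy.trans hnm)
    rw [hU, hm.measure_iUnion] at hC
    exact lt_iSup_iff.1 hC
  choose g hg using step
  let D : ℕ → {C : Set (ℕ → ℕ) // c < μ (f '' C)} := fun k =>
    Nat.rec ⟨Set.univ, by simpa using hc⟩ (fun k C => ⟨C.1 ∩ {y | y k ≤ g k C}, hg k C⟩) k
  let N : ℕ → ℕ := fun k => g k (D k)
  have hD : ∀ k, (D k).1 = {y | ∀ i < k, y i ≤ N i} := by
    intro k
    induction k with
    | zero => ext; simp [D]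
    | succ k ih =>
      have : (D (k + 1)).1 = (D k).1 ∩ {y | y k ≤ N k} := rfl
      rw [this, ih]
      ext y
      simp only [Set.mem_inter_iff, Set.mem_ofPred_eq, Nat.lt_succ_iff_lt_or_eq, or_imp,
        forall_and, forall_eq]
  let K : Set (ℕ → ℕ) := Set.pi Set.univ fun i => Set.Iic (N i)
  have hK : IsCompact K := isCompact_univ_pi fun i => (Set.finite_Iic (N i)).isCompact
  refine ⟨f '' K, Set.image_subset_range _ _, hK.image hf, ?_⟩
  rw [Set.measure_eq_iInf_isOpen]
  refine le_iInf₂ fun U hU => le_iInf fun hUo => ?_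
  have hV : IsOpen (f ⁻¹' U) := hUo.preimage hf
  have hKV : K ⊆ f ⁻¹' U := Set.image_subset_iff.1 hU
  have hcyl : ∀ z ∈ K, ∃ n, PiNat.cylinder z n ⊆ f ⁻¹' U := by
    intro z hz
    obtain ⟨s, ⟨w, n, rfl⟩, hzs, hs⟩ :=
      (PiNat.isTopologicalBasis_cylinders (fun _ => ℕ)).exists_subset_of_mem_open (hKV hz) hV
    refine ⟨n, ?_⟩
    rwa [PiNat.mem_cylinder_iff_eq.1 hzs]
  choose! n hn using hcyl
  obtain ⟨t, htK, htc⟩ := hK.elim_nhds_subcover (fun z => PiNat.cylinder z (n z)) fun z _ =>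
    (PiNat.isOpen_cylinder (fun _ => ℕ) z (n z)).mem_nhds (PiNat.self_mem_cylinder z _)
  let k := t.sup n
  have hsub : (D k).1 ⊆ f ⁻¹' U := by
    intro y hy
    rw [hD] at hy
    have hz : (fun i => min (y i) (N i)) ∈ K := fun i _ =>
      Set.mem_Iic.2 (min_le_right _ _)
    obtain ⟨w, hwt, hw⟩ := Set.mem_iUnion₂.1 (htc hz)
    refine hn w (htK w hwt) fun i hi => ?_
    rw [← hw i hi]
    exact (min_eq_left (hy i (hi.trans_le (Finset.le_sup (f := n) hwt)))).symm
  exact (D k).2.le.trans (measure_mono (Set.image_subset_iff.2 hsub))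

/-- Lusin's theorem: analytic sets are universally measurable. -/
lemma nullMeasurableSet_of_analyticSet {α : Type*} [TopologicalSpace α] [PolishSpace α]
    [MeasurableSpace α] [BorelSpace α] {s : Set α} (hs : AnalyticSet s)
    (μ : Measure α) [IsFiniteMeasure μ] : NullMeasurableSet s μ := by
  rw [AnalyticSet] at hs
  obtain rfl | ⟨f, hf, rfl⟩ := hs
  · exact nullMeasurableSet_empty
  obtain h0 | h0 := eq_or_ne (μ (Set.range f)) 0
  · exact NullMeasurableSet.of_null h0
  obtain ⟨u, -, hu, hlim⟩ := exists_seq_strictMono_tendsto' (pos_iff_ne_zero.2 h0)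
  choose K hKs hKc hK using fun n => exists_isCompact_image_measure_gt μ hf (hu n).2
  have hm : MeasurableSet (⋃ n, K n) := MeasurableSet.iUnion fun n => (hKc n).measurableSet
  have hle : μ (Set.range f) ≤ μ (⋃ n, K n) :=
    le_of_tendsto' hlim fun n => (hK n).trans (measure_mono (Set.subset_iUnion K n))
  exact hm.nullMeasurableSet.congr (ae_eq_of_subset_of_measure_ge (Set.iUnion_subset hKs) hle
    hm.nullMeasurableSet (measure_ne_top _ _))

/-- The cylinders used to select the lexicographically least point of a subset of the Baire
space. -/
def lexCyl (F : Set (ℕ → ℕ)) : ℕ → Set (ℕ → ℕ)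
  | 0 => F
  | k + 1 => {z ∈ lexCyl F k | z k = sInf ((fun w : ℕ → ℕ => w k) '' lexCyl F k)}

/-- The lexicographically least point of a nonempty closed subset of the Baire space. -/
def lexMin (F : Set (ℕ → ℕ)) (k : ℕ) : ℕ := sInf ((fun w : ℕ → ℕ => w k) '' lexCyl F k)

lemma lexCyl_eq (F : Set (ℕ → ℕ)) (k : ℕ) :
    lexCyl F k = {z ∈ F | ∀ i < k, z i = lexMin F i} := by
  induction k with
  | zero => simp [lexCyl]
  | succ k ih =>
    change {z ∈ lexCyl F k | z k = lexMin F k} = _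
    rw [ih]
    ext z
    simp only [Set.mem_ofPred_eq, Nat.lt_succ_iff_lt_or_eq, or_imp, forall_and, forall_eq,
      and_assoc]

lemma lexCyl_nonempty {F : Set (ℕ → ℕ)} (hF : F.Nonempty) (k : ℕ) : (lexCyl F k).Nonempty := by
  induction k with
  | zero => exact hF
  | succ k ih =>
    obtain ⟨z, hz, hzk⟩ := Nat.sInf_mem (ih.image fun w : ℕ → ℕ => w k)
    exact ⟨z, hz, hzk⟩

lemma lexMin_mem {F : Set (ℕ → ℕ)} (hF : F.Nonempty) (hc : IsClosed F) : lexMin F ∈ F := by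
  choose z hz using fun k => lexCyl_nonempty hF k
  simp only [lexCyl_eq, Set.mem_ofPred_eq] at hz
  refine hc.mem_of_tendsto (f := z) (b := atTop) ?_ (Eventually.of_forall fun k => (hz k).1)
  refine tendsto_pi_nhds.2 fun i => tendsto_const_nhds.congr' ?_
  filter_upwards [eventually_gt_atTop i] with k hk
  exact ((hz k).2 i hk).symm

lemma lexMin_eq_iff {F : Set (ℕ → ℕ)} (hF : F.Nonempty) (k m : ℕ) :
    lexMin F k = m ↔ (∃ z ∈ lexCyl F k, z k = m) ∧ ¬ ∃ z ∈ lexCyl F k, z k < m := by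
  constructor
  · rintro rfl
    obtain ⟨z, hz, hzk⟩ := Nat.sInf_mem ((lexCyl_nonempty hF k).image fun w : ℕ → ℕ => w k)
    exact ⟨⟨z, hz, hzk⟩, fun ⟨w, hw, hlt⟩ => hlt.not_ge (Nat.sInf_le ⟨w, hw, rfl⟩)⟩
  · rintro ⟨⟨z, hz, rfl⟩, hno⟩
    refine le_antisymm (Nat.sInf_le ⟨z, hz, rfl⟩) (not_lt.1 fun hlt => hno ?_)
    obtain ⟨w, hw, hwk⟩ := Nat.sInf_mem ((lexCyl_nonempty hF k).image fun w : ℕ → ℕ => w k)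
    exact ⟨w, hw, hwk.trans_lt hlt⟩

/-- Jankov–von Neumann: a continuous map from the Baire space has a universally measurable
right inverse on its range. -/
lemma exists_section_of_continuous {α : Type*} [TopologicalSpace α] [PolishSpace α]
    [MeasurableSpace α] [BorelSpace α] {f : (ℕ → ℕ) → α} (hf : Continuous f) :
    ∃ σ : α → ℕ → ℕ, (∀ y ∈ Set.range f, f (σ y) = y) ∧
      ∀ (μ : Measure α) [IsFiniteMeasure μ], AEMeasurable σ μ := by
  let σ : α → ℕ → ℕ := fun y => lexMin (f ⁻¹' {y})
  refine ⟨σ, fun y hy => ?_, fun μ _ => ?_⟩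
  · exact lexMin_mem (F := f ⁻¹' {y}) hy (isClosed_singleton.preimage hf)
  have himg : ∀ {U : Set (ℕ → ℕ)}, IsOpen U → NullMeasurableSet (f '' U) μ := fun hU =>
    nullMeasurableSet_of_analyticSet (hU.analyticSet_image hf) μ
  have hR : NullMeasurableSet (Set.range f) μ := by
    rw [← Set.image_univ]; exact himg isOpen_univ
  have hcylo : ∀ (k : ℕ) (w : ℕ → ℕ), IsOpen {z : ℕ → ℕ | ∀ i < k, z i = w i} := fun k w =>
    PiNat.isOpen_cylinder (fun _ => ℕ) w k
  have key : ∀ (k : ℕ) (w : ℕ → ℕ),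
      NullMeasurableSet {y | y ∈ Set.range f ∧ ∀ i < k, σ y i = w i} μ := by
    intro k
    induction k with
    | zero =>
      intro w
      convert hR using 1
      ext; simp
    | succ k ih =>
      intro w
      have heq : {y | y ∈ Set.range f ∧ ∀ i < k + 1, σ y i = w i} =
          ({y | y ∈ Set.range f ∧ ∀ i < k, σ y i = w i} ∩
            f '' ({z | ∀ i < k, z i = w i} ∩ {z | z k = w k})) \
            f '' ({z | ∀ i < k, z i = w i} ∩ {z | z k < w k}) := by
        ext y
        simp only [Set.mem_ofPred_eq, Set.mem_sdiff, Set.mem_inter_iff, Nat.lt_succ_iff_lt_or_eq,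
          or_imp, forall_and, forall_eq, ← and_assoc]
        rw [and_assoc (c := y ∉ f '' _)]
        refine and_congr_right fun ⟨hy, hw⟩ => ?_
        have hcyl : lexCyl (f ⁻¹' {y}) k = {z | f z = y ∧ ∀ i < k, z i = w i} := by
          rw [lexCyl_eq]
          ext z
          refine and_congr_right fun _ => forall₂_congr fun i hi => ?_
          rw [← hw i hi]
        change lexMin (f ⁻¹' {y}) k = w k ↔ _
        rw [lexMin_eq_iff (F := f ⁻¹' {y}) hy, hcyl]
        refine and_congr ?_ (not_congr ?_)
        · exact exists_congr fun z =>
            ⟨fun h => ⟨⟨h.1.2, h.2⟩, h.1.1⟩, fun h => ⟨⟨h.2, h.1.1⟩, h.1.2⟩⟩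
        · exact exists_congr fun z =>
            ⟨fun h => ⟨⟨h.1.2, h.2⟩, h.1.1⟩, fun h => ⟨⟨h.2, h.1.1⟩, h.1.2⟩⟩
      rw [heq]
      refine ((ih w).inter (himg ((hcylo k w).inter ?_))).diff (himg ((hcylo k w).inter ?_))
      · exact (isOpen_discrete {w k}).preimage (continuous_apply (A := fun _ : ℕ => ℕ) k)
      · exact (isOpen_discrete (Set.Iio (w k))).preimage (continuous_apply (A := fun _ : ℕ => ℕ) k)
  refine aemeasurable_pi_iff.2 fun k => NullMeasurable.aemeasurable fun s _ => ?_
  have heq : (fun y => σ y k) ⁻¹' s =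
      (⋃ w : Fin (k + 1) → ℕ, {y | w (Fin.last k) ∈ s ∧ y ∈ Set.range f ∧
        ∀ i < k + 1, σ y i = Function.extend Fin.val w 0 i}) ∪
      {y | y ∉ Set.range f ∧ lexMin ∅ k ∈ s} := by
    ext y
    simp only [Set.mem_preimage, Set.mem_union, Set.mem_iUnion, Set.mem_ofPred_eq]
    by_cases hy : y ∈ Set.range f
    · simp only [hy, true_and, not_true_eq_false, false_and, or_false]
      have hext : ∀ (w : Fin (k + 1) → ℕ) (i : ℕ) (hi : i < k + 1),
          Function.extend Fin.val w 0 i = w ⟨i, hi⟩ := fun w i hi =>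
        Fin.val_injective.extend_apply w 0 ⟨i, hi⟩
      constructor
      · intro h
        exact ⟨fun i => σ y i, h, fun i hi => (hext (fun i => σ y i) i hi).symm⟩
      · rintro ⟨w, hw, hσ⟩
        rw [hσ k k.lt_succ_self, hext w k k.lt_succ_self]
        exact hw
    · have h0 : f ⁻¹' {y} = ∅ := by
        rw [Set.preimage_singleton_eq_empty]; exact hy
      have hσ : σ y = lexMin ∅ := by rw [← h0]
      simp [hy, hσ]
  rw [heq]
  refine (NullMeasurableSet.iUnion fun w => ?_).union ?_
  · exact (NullMeasurableSet.const _).inter (key (k + 1) _)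
  · exact hR.compl.inter (NullMeasurableSet.const _)

/-- A multifunction with analytic graph and nonempty values has a universally measurable
selector. -/
lemma exists_selector {X A : Type*} [TopologicalSpace X] [PolishSpace X] [MeasurableSpace X]
    [BorelSpace X] [TopologicalSpace A] [PolishSpace A] [MeasurableSpace A] [BorelSpace A]
    {Acts : X → Set A} (hne : ∀ x, (Acts x).Nonempty)
    (hΓ : AnalyticSet {xa : X × A | xa.2 ∈ Acts xa.1}) :
    ∃ s : X → A, (∀ x, s x ∈ Acts x) ∧
      ∀ (μ : Measure X) [IsFiniteMeasure μ], AEMeasurable s μ := by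
  rw [AnalyticSet] at hΓ
  obtain h0 | ⟨f, hf, hr⟩ := hΓ
  · have hX : IsEmpty X := ⟨fun x => by
      obtain ⟨a, ha⟩ := hne x
      exact (h0 ▸ (show (x, a) ∈ {xa : X × A | xa.2 ∈ Acts xa.1} from ha) : (x, a) ∈ (∅ : Set _))⟩
    exact ⟨fun x => hX.elim x, fun x => hX.elim x, fun μ _ => (measurable_of_empty _).aemeasurable⟩
  · obtain ⟨σ, hσ, hm⟩ := exists_section_of_continuous (continuous_fst.comp hf)
    have hsurj : ∀ x, x ∈ Set.range (Prod.fst ∘ f) := by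
      intro x
      obtain ⟨a, ha⟩ := hne x
      obtain ⟨z, hz⟩ := hr.ge (show (x, a) ∈ {xa : X × A | xa.2 ∈ Acts xa.1} from ha)
      exact ⟨z, by simp [hz]⟩
    refine ⟨fun x => (f (σ x)).2, fun x => ?_, fun μ _ =>
      (continuous_snd.comp hf).measurable.comp_aemeasurable (hm μ)⟩
    have h1 : (f (σ x)).2 ∈ Acts (f (σ x)).1 := hr.le ⟨σ x, rfl⟩
    have h2 : (f (σ x)).1 = x := hσ x (hsurj x)
    rwa [h2] at h1

section ProbabilityMeasureBorel

variable {Y : Type*} [TopologicalSpace Y] [PolishSpace Y] [MeasurableSpace Y] [BorelSpace Y]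

/-- Evaluation at an open set is lower semicontinuous on probability measures. -/
lemma isOpen_lt_probabilityMeasure {G : Set Y} (hG : IsOpen G) (r : ℝ≥0) :
    IsOpen {p : ProbabilityMeasure Y | (r : ℝ≥0∞) < p.toMeasure G} := by
  let _ := TopologicalSpace.upgradeIsCompletelyMetrizable Y
  refine isOpen_iff_mem_nhds.2 fun p hp => ?_
  have h := ProbabilityMeasure.le_liminf_measure_open_of_tendsto
    (tendsto_id (x := 𝓝 p)) hG
  exact eventually_lt_of_lt_liminf (lt_of_lt_of_le hp h)

/-- A countable subbasis of the topology of weak convergence. -/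
def probSubbasis (Y : Type*) [TopologicalSpace Y] [SecondCountableTopology Y]
    [MeasurableSpace Y] : Set (Set (ProbabilityMeasure Y)) :=
  Set.range fun x : ℚ × Finset (TopologicalSpace.countableBasis Y) =>
    {p : ProbabilityMeasure Y | ((x.1 : ℝ).toNNReal : ℝ≥0∞) < p.toMeasure (⋃ t ∈ x.2, t.1)}

lemma isOpen_biUnion_countableBasis {Y : Type*} [TopologicalSpace Y] [SecondCountableTopology Y]
    (T : Finset (TopologicalSpace.countableBasis Y)) :
    IsOpen (⋃ t ∈ T, t.1) :=
  isOpen_biUnion fun t _ => TopologicalSpace.isOpen_of_mem_countableBasis t.2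

lemma probabilityMeasure_topology_eq :
    (inferInstance : TopologicalSpace (ProbabilityMeasure Y))
      = TopologicalSpace.generateFrom (probSubbasis Y) := by
  let _ := TopologicalSpace.upgradeIsCompletelyMetrizable Y
  refine le_antisymm ?_ ?_
  · refine le_generateFrom ?_
    rintro _ ⟨x, rfl⟩
    exact isOpen_lt_probabilityMeasure (isOpen_biUnion_countableBasis x.2) _
  · rw [le_iff_nhds]
    intro p
    have hcg :
        (@nhds _ (TopologicalSpace.generateFrom (probSubbasis Y)) p).IsCountablyGenerated := by
      have : @SecondCountableTopology _ (TopologicalSpace.generateFrom (probSubbasis Y)) :=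
        @SecondCountableTopology.mk _ (TopologicalSpace.generateFrom (probSubbasis Y))
          ⟨probSubbasis Y, Set.countable_range _, rfl⟩
      exact @FirstCountableTopology.nhds_generated_countable _
        (TopologicalSpace.generateFrom (probSubbasis Y)) inferInstance p
    change Tendsto id _ _
    refine tendsto_of_forall_isOpen_le_liminf' (μs := id) fun G hG => ?_
    refine le_of_forall_lt fun c hc => ?_
    obtain ⟨r, hcr, hr⟩ := ENNReal.lt_iff_exists_nnreal_btwn.1 hc
    obtain ⟨s, _, hrs, hs⟩ := ENNReal.lt_iff_exists_rat_btwn.1 hr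
    have hs' : (s : ℝ).toNNReal < p G := by
      rwa [← ENNReal.coe_lt_coe, ProbabilityMeasure.ennreal_coeFn_eq_coeFn_toMeasure]
    obtain ⟨T, hT, hlt, hsub⟩ := p.exists_lt_measure_biUnion_of_isOpen
      (S := TopologicalSpace.countableBasis Y) (fun u hu x hx => by
        obtain ⟨v, hv, hxv, hvu⟩ :=
          (TopologicalSpace.isBasis_countableBasis Y).exists_subset_of_mem_open hx hu
        exact ⟨v, hv, (TopologicalSpace.isOpen_of_mem_countableBasis hv).mem_nhds hxv, hvu⟩)
      hG hs'
    classical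
    let T' : Finset (TopologicalSpace.countableBasis Y) := T.subtype _
    have hTT : (⋃ t ∈ T', t.1) = ⋃ t ∈ T, t := by
      ext y
      simp only [Set.mem_iUnion, T', Finset.mem_subtype, Subtype.exists, exists_prop]
      exact ⟨fun ⟨a, _, ha, hy⟩ => ⟨a, ha, hy⟩, fun ⟨a, ha, hy⟩ => ⟨a, hT a ha, ha, hy⟩⟩
    have hmem : {p : ProbabilityMeasure Y | ((s : ℝ).toNNReal : ℝ≥0∞) < p.toMeasure (⋃ t ∈ T', t.1)}
        ∈ @nhds _ (TopologicalSpace.generateFrom (probSubbasis Y)) p := by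
      refine @IsOpen.mem_nhds _ (TopologicalSpace.generateFrom (probSubbasis Y)) _ _
        (TopologicalSpace.isOpen_generateFrom_of_mem ⟨(s, T'), rfl⟩) ?_
      rw [Set.mem_ofPred_eq, hTT, ← ProbabilityMeasure.ennreal_coeFn_eq_coeFn_toMeasure]
      exact_mod_cast hlt
    refine (hcr.trans hrs).trans_le (le_liminf_of_le (by isBoundedDefault) ?_)
    filter_upwards [hmem] with p' hp'
    refine hp'.le.trans (measure_mono ?_)
    rw [hTT]
    exact hsub

instance secondCountableTopology_probabilityMeasure :
    SecondCountableTopology (ProbabilityMeasure Y) :=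
  ⟨probSubbasis Y, Set.countable_range _, probabilityMeasure_topology_eq⟩

instance borelSpace_probabilityMeasure : BorelSpace (ProbabilityMeasure Y) := ⟨rfl⟩

lemma measurable_toMeasure : Measurable fun p : ProbabilityMeasure Y => p.toMeasure := by
  refine Measurable.measure_of_isPiSystem_of_isProbabilityMeasure
    (S := {s : Set Y | IsOpen s}) BorelSpace.measurable_eq isPiSystem_isOpen ?_
  intro G hG
  refine measurable_of_Ioi fun c => ?_
  by_cases hc : c = ⊤
  · simp [hc]
  · lift c to ℝ≥0 using hc
    exact (isOpen_lt_probabilityMeasure hG c).measurableSet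

lemma measurable_of_measurable_toMeasure {Z : Type*} [MeasurableSpace Z]
    {G : Z → ProbabilityMeasure Y} (hG : Measurable fun z => (G z).toMeasure) : Measurable G := by
  have h : instMeasProb (Ω := Y) = MeasurableSpace.generateFrom (probSubbasis Y) :=
    borel_eq_generateFrom_of_subbasis probabilityMeasure_topology_eq
  rw [show (instMeasProb (Ω := Y)) = _ from h]
  refine measurable_generateFrom ?_
  rintro _ ⟨x, rfl⟩
  exact measurableSet_lt measurable_const
    ((Measure.measurable_coe (isOpen_biUnion_countableBasis x.2).measurableSet).comp hG)

end ProbabilityMeasureBorel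

section AnalyticConcentration

/-- Every probability measure on `ℝ` is obtained from a measurable family indexed by `ℚ → ℝ`. -/
lemma exists_measurable_family_real :
    ∃ M : (ℚ → ℝ) → Measure ℝ, Measurable M ∧ (∀ z, IsProbabilityMeasure (M z)) ∧
      ∀ μ : Measure ℝ, IsProbabilityMeasure μ → ∃ z, M z = μ := by
  refine ⟨fun z => (stieltjesOfMeasurableRat id measurable_id z).measure,
    measurable_measure_stieltjesOfMeasurableRat measurable_id, fun z => inferInstance, ?_⟩
  intro μ hμ
  have hst : IsRatStieltjesPoint (id : (ℚ → ℝ) → ℚ → ℝ) (fun r : ℚ => cdf μ r) := by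
    refine ⟨fun a b hab => monotone_cdf μ (by exact_mod_cast hab),
      (tendsto_cdf_atTop μ).comp (tendsto_ratCast_atTop_iff.2 tendsto_id),
      (tendsto_cdf_atBot μ).comp (tendsto_ratCast_atBot_iff.2 tendsto_id), fun t => ?_⟩
    rw [id, ← StieltjesFunction.iInf_rat_gt_eq (cdf μ) (t : ℝ)]
    exact Equiv.iInf_congr (Equiv.subtypeEquivRight fun r => by simp) fun r => rfl
  refine ⟨fun r : ℚ => cdf μ r, ?_⟩
  refine ext_of_generate_finite _ Real.borel_eq_generateFrom_Iic_rat
    Real.isPiSystem_Iic_rat ?_ (by simp)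
  rintro _ hs
  obtain ⟨r, rfl⟩ := Set.mem_iUnion.1 hs
  rw [measure_stieltjesOfMeasurableRat_Iic, stieltjesOfMeasurableRat_eq,
    toRatCDF_of_isRatStieltjesPoint hst, id, ofReal_cdf]

/-- Every probability measure on a nonempty standard Borel space is obtained from a measurable
family indexed by `ℚ → ℝ`. -/
lemma exists_measurable_family (Ω : Type*) [MeasurableSpace Ω] [StandardBorelSpace Ω]
    [Nonempty Ω] :
    ∃ M : (ℚ → ℝ) → Measure Ω, Measurable M ∧ (∀ z, IsProbabilityMeasure (M z)) ∧
      ∀ μ : Measure Ω, IsProbabilityMeasure μ → ∃ z, M z = μ := by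
  obtain ⟨M, hM, hp, hs⟩ := exists_measurable_family_real
  have he := measurableEmbedding_embeddingReal Ω
  refine ⟨fun z => (M z).map he.invFun, (Measure.measurable_map _ he.measurable_invFun).comp hM,
    fun z => Measure.isProbabilityMeasure_map he.measurable_invFun.aemeasurable, fun μ hμ => ?_⟩
  obtain ⟨z, hz⟩ := hs (μ.map (embeddingReal Ω))
    (Measure.isProbabilityMeasure_map he.measurable.aemeasurable)
  refine ⟨z, ?_⟩
  simp only [hz]
  rw [Measure.map_map he.measurable_invFun he.measurable, he.leftInverse_invFun.comp_eq_id,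
    Measure.map_id]

/-- The probability measures in a Borel set which are concentrated on an analytic set form an
analytic set. -/
lemma analyticSet_concentrated {Y : Type*} [TopologicalSpace Y] [PolishSpace Y]
    [MeasurableSpace Y] [BorelSpace Y] {T : Set Y} (hT : AnalyticSet T)
    {B : Set (ProbabilityMeasure Y)} (hB : MeasurableSet B) :
    AnalyticSet {p : ProbabilityMeasure Y | p ∈ B ∧ ∀ᵐ ω ∂p.toMeasure, ω ∈ T} := by
  have hnull := fun p : ProbabilityMeasure Y => nullMeasurableSet_of_analyticSet hT p.toMeasure
  rw [AnalyticSet] at hT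
  rcases hT with rfl | ⟨f, hf, rfl⟩
  · have : {p : ProbabilityMeasure Y | p ∈ B ∧ ∀ᵐ ω ∂p.toMeasure, ω ∈ (∅ : Set Y)} = ∅ := by
      ext p
      simpa using fun _ => IsProbabilityMeasure.ne_zero p.toMeasure
    rw [this]
    exact analyticSet_empty
  obtain ⟨M, hM, hMp, hMs⟩ := exists_measurable_family (ℕ → ℕ)
  let G : (ℚ → ℝ) → ProbabilityMeasure Y := fun z =>
    ⟨(M z).map f, Measure.isProbabilityMeasure_map hf.measurable.aemeasurable⟩
  have hG : Measurable G := measurable_of_measurable_toMeasure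
    ((Measure.measurable_map _ hf.measurable).comp hM)
  have hrange : {p : ProbabilityMeasure Y | p ∈ B ∧ ∀ᵐ ω ∂p.toMeasure, ω ∈ Set.range f}
      = G '' (G ⁻¹' B) := by
    ext p
    constructor
    · rintro ⟨hpB, hp⟩
      obtain ⟨σ, hσ, hσm⟩ := exists_section_of_continuous hf
      have hσp := hσm p.toMeasure
      obtain ⟨z, hz⟩ := hMs (p.toMeasure.map σ) (Measure.isProbabilityMeasure_map hσp)
      have hGz : G z = p := by
        apply Subtype.ext
        change (M z).map f = p.toMeasure
        rw [hz, AEMeasurable.map_map_of_aemeasurable hf.measurable.aemeasurable hσp]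
        conv_rhs => rw [← Measure.map_id (μ := p.toMeasure)]
        refine Measure.map_congr ?_
        filter_upwards [hp] with y hy
        exact hσ y hy
      exact ⟨z, by rwa [Set.mem_preimage, hGz], hGz⟩
    · rintro ⟨z, hz, rfl⟩
      refine ⟨hz, ?_⟩
      change (G z).toMeasure (Set.range f)ᶜ = 0
      have h : (G z).toMeasure (Set.range f)ᶜ = M z (f ⁻¹' (Set.range f)ᶜ) :=
        Measure.map_apply₀ hf.measurable.aemeasurable (hnull (G z)).compl
      rw [h, Set.preimage_compl, Set.preimage_range, Set.compl_univ, measure_empty]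
  rw [hrange]
  exact MeasurableSet.analyticSet_image (hG hB) hG

end AnalyticConcentration

section MeasureLemmas

lemma exists_countable_piSystem (Y : Type*) [mY : MeasurableSpace Y]
    [MeasurableSpace.CountablyGenerated Y] :
    ∃ S : Set (Set Y), S.Countable ∧ IsPiSystem S ∧ mY = MeasurableSpace.generateFrom S := by
  refine ⟨generateSetAlgebra (MeasurableSpace.countableGeneratingSet Y),
    countable_generateSetAlgebra (MeasurableSpace.countable_countableGeneratingSet),
    fun s hs t ht _ => isSetAlgebra_generateSetAlgebra.inter_mem hs ht, ?_⟩
  rw [generateFrom_generateSetAlgebra_eq, MeasurableSpace.generateFrom_countableGeneratingSet]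

lemma measurableSet_kernel_eq {Z Y : Type*} [MeasurableSpace Z] [MeasurableSpace Y]
    [MeasurableSpace.CountablyGenerated Y] (κ η : Kernel Z Y) [IsMarkovKernel κ]
    [IsMarkovKernel η] : MeasurableSet {z | κ z = η z} := by
  obtain ⟨S, hS, hpi, hgen⟩ := exists_countable_piSystem Y
  have hSm : ∀ s ∈ S, MeasurableSet s := fun s hs =>
    hgen ▸ MeasurableSpace.measurableSet_generateFrom hs
  have : {z | κ z = η z} = ⋂ s ∈ S, {z | κ z s = η z s} := by
    ext z
    simp only [Set.mem_ofPred_eq, Set.mem_iInter]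
    exact ⟨fun h s _ => by rw [h], fun h => ext_of_generate_finite S hgen hpi h (by simp)⟩
  rw [this]
  exact MeasurableSet.biInter hS fun s hs => measurableSet_eq_fun
    (κ.measurable_coe (hSm s hs)) (η.measurable_coe (hSm s hs))

/-- A family of probability measures whose values on measurable sets are almost everywhere
measurable agrees almost everywhere with a Markov kernel. -/
lemma exists_kernel_ae_eq {I A : Type*} [MeasurableSpace I] [MeasurableSpace A] [Nonempty A]
    [MeasurableSpace.CountablyGenerated A] (ρ : Measure I) (m : I → Measure A)
    (hm : ∀ i, IsProbabilityMeasure (m i))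
    (hae : ∀ B, MeasurableSet B → AEMeasurable (fun i => m i B) ρ) :
    ∃ M : Kernel I A, IsMarkovKernel M ∧ ∀ᵐ i ∂ρ, M i = m i := by
  obtain ⟨S, hS, hpi, hgen⟩ := exists_countable_piSystem A
  have hSm : ∀ s ∈ S, MeasurableSet s := fun s hs =>
    hgen ▸ MeasurableSpace.measurableSet_generateFrom hs
  have hall : ∀ᵐ i ∂ρ, ∀ s (hs : s ∈ S), m i s = (hae s (hSm s hs)).mk _ i :=
    (ae_ball_iff hS).2 fun s hs => (hae s (hSm s hs)).ae_eq_mk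
  obtain ⟨N, hN, hNm, hNm'⟩ := hall.exists_measurable_mem
  classical
  let a₀ : A := Classical.arbitrary A
  let M : I → Measure A := fun i => if i ∈ N then m i else Measure.dirac a₀
  have hMp : ∀ i, IsProbabilityMeasure (M i) := fun i => by
    by_cases hi : i ∈ N
    · simpa [M, hi] using hm i
    · simpa [M, hi] using Measure.dirac.isProbabilityMeasure
  have hMm : Measurable M := by
    refine Measurable.measure_of_isPiSystem_of_isProbabilityMeasure hgen hpi fun s hs => ?_
    have : (fun i => M i s)
        = fun i => if i ∈ N then (hae s (hSm s hs)).mk _ i else Measure.dirac a₀ s := by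
      ext i
      by_cases hi : i ∈ N
      · simp [M, hi, hNm' i hi s hs]
      · simp [M, hi]
    rw [this]
    exact Measurable.ite hNm (hae s (hSm s hs)).measurable_mk measurable_const
  refine ⟨⟨M, hMm⟩, ⟨hMp⟩, ?_⟩
  filter_upwards [hN] with i hi
  exact if_pos hi

/-- A probability measure is a Dirac measure iff its square charges only the diagonal. -/
lemma exists_eq_dirac_iff {A : Type*} [MeasurableSpace A] [MeasurableEq A]
    (μ : Measure A) [IsProbabilityMeasure μ] :
    (∃ a, μ = Measure.dirac a) ↔ μ.prod μ (Set.diagonal A) = 1 := by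
  constructor
  · rintro ⟨a, rfl⟩
    rw [Measure.dirac_prod_dirac, Measure.dirac_apply_of_mem (Set.mem_diagonal a)]
  · intro h
    have hae : ∀ᵐ x ∂μ.prod μ, x ∈ Set.diagonal A := by
      rw [← mem_ae_iff_prob_eq_one measurableSet_diagonal] at h
      exact h
    obtain ⟨a, ha⟩ := (Measure.ae_ae_of_ae_prod hae).exists
    refine ⟨a, ?_⟩
    have hμ : μ = μ.map fun _ => a := by
      conv_lhs => rw [← Measure.map_id (μ := μ)]
      refine Measure.map_congr ?_
      filter_upwards [ha] with b hb
      exact (Set.mem_diagonal_iff.1 hb).symm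
    rw [hμ, Measure.map_const, measure_univ, one_smul]

lemma measurableSet_eq_dirac {I A : Type*} [MeasurableSpace I] [MeasurableSpace A]
    [MeasurableEq A] (K : Kernel I A) [IsMarkovKernel K] :
    MeasurableSet {i | ∃ a, K i = Measure.dirac a} := by
  have : {i | ∃ a, K i = Measure.dirac a} = {i | (K ×ₖ K) i (Set.diagonal A) = 1} := by
    ext i
    rw [Set.mem_ofPred_eq, exists_eq_dirac_iff, Set.mem_ofPred_eq, Kernel.prod_apply]
  rw [this]
  exact measurableSet_eq_fun ((K ×ₖ K).measurable_coe measurableSet_diagonal) measurable_const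

end MeasureLemmas

section Histories

variable {X A : Type*} [MeasurableSpace X] [MeasurableSpace A]

/-- The history `h_n` of a trajectory. -/
def histMap (n : ℕ) (ω : Traj X A) : Hist X A n := (fun i => ω i, (ω n).1)

lemma measurable_histMap (n : ℕ) : Measurable (histMap (X := X) (A := A) n) := by
  unfold histMap
  fun_prop

/-- Appending an action and a state to a history. -/
def snocHist {n : ℕ} (z : (Hist X A n × A) × X) : Hist X A (n + 1) :=
  (Fin.snoc z.1.1.1 (z.1.1.2, z.1.2), z.2)

/-- Splitting off the last action and state of a history. -/
def unsnocHist {n : ℕ} (h : Hist X A (n + 1)) : Hist X A n × A :=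
  ((fun i => h.1 i.castSucc, (h.1 (Fin.last n)).1), (h.1 (Fin.last n)).2)

lemma measurable_snocHist {n : ℕ} : Measurable (snocHist (X := X) (A := A) (n := n)) := by
  refine Measurable.prodMk (measurable_pi_iff.2 fun i => ?_) measurable_snd
  refine Fin.lastCases ?_ (fun i => ?_) i
  · simp only [Fin.snoc_last]
    fun_prop
  · simp only [Fin.snoc_castSucc]
    fun_prop

lemma measurable_unsnocHist {n : ℕ} : Measurable (unsnocHist (X := X) (A := A) (n := n)) := by
  unfold unsnocHist
  fun_prop

lemma unsnocHist_snocHist {X A : Type*} {n : ℕ} (z : (Hist X A n × A) × X) :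
    unsnocHist (snocHist z) = z.1 := by
  simp [unsnocHist, snocHist]

/-- The law of the next history, given the law of the current one and the decision kernel. -/
def stepMeasure (q : Kernel (X × A) X) {n : ℕ} (L : Measure (Hist X A n))
    (m : Kernel (Hist X A n) A) : Measure (Hist X A (n + 1)) :=
  ((L ⊗ₘ m) ⊗ₘ q.comap (fun z => (z.1.2, z.2)) (by fun_prop)).map snocHist

lemma map_unsnocHist_stepMeasure (q : Kernel (X × A) X) [IsMarkovKernel q] {n : ℕ}
    (L : Measure (Hist X A n)) [SFinite L] (m : Kernel (Hist X A n) A) [IsSFiniteKernel m] :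
    (stepMeasure q L m).map unsnocHist = L ⊗ₘ m := by
  rw [stepMeasure, Measure.map_map measurable_unsnocHist measurable_snocHist,
    show unsnocHist ∘ snocHist = Prod.fst from
      funext (unsnocHist_snocHist (X := X) (A := A) (n := n))]
  exact Measure.fst_compProd _ _

lemma stepMeasure_congr (q : Kernel (X × A) X) {n : ℕ} {L : Measure (Hist X A n)}
    {m m' : Kernel (Hist X A n) A} [IsSFiniteKernel m] [IsSFiniteKernel m']
    (h : m =ᵐ[L] m') : stepMeasure q L m = stepMeasure q L m' := by
  rw [stepMeasure, Measure.compProd_congr h, stepMeasure]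

/-- The one-step recursion of the iterated integrals, for almost everywhere measurable
integrands. -/
lemma histInt_succ_eq (q : Kernel (X × A) X) [IsMarkovKernel q] {p0 : Measure X}
    {ν : ∀ n : ℕ, Hist X A n → Measure A} {n : ℕ} {L : Measure (Hist X A n)} [SFinite L]
    {m : Kernel (Hist X A n) A} [IsMarkovKernel m] (hm : ∀ᵐ h ∂L, m h = ν n h)
    (hL : ∀ F : Hist X A n → ℝ≥0∞, AEMeasurable F L → histInt p0 q ν n F = ∫⁻ h, F h ∂L)
    {F : Hist X A (n + 1) → ℝ≥0∞} (hF : AEMeasurable F (stepMeasure q L m)) :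
    histInt p0 q ν (n + 1) F = ∫⁻ h, F h ∂(stepMeasure q L m) := by
  let F₀ := hF.mk F
  have hF₀ : Measurable F₀ := hF.measurable_mk
  have hFF : ∀ᵐ h ∂L, ∀ᵐ a ∂m h, ∀ᵐ y ∂q (h.2, a),
      F (snocHist ((h, a), y)) = F₀ (snocHist ((h, a), y)) := by
    have h1 := ae_of_ae_map measurable_snocHist.aemeasurable hF.ae_eq_mk
    exact Measure.ae_ae_of_ae_compProd (Measure.ae_ae_of_ae_compProd h1)
  have hin : (fun h : Hist X A n => ∫⁻ a, ∫⁻ y, F (Fin.snoc h.1 (h.2, a), y) ∂(q (h.2, a)) ∂(ν n h))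
      =ᵐ[L] fun h => ∫⁻ a, ∫⁻ y, F₀ (snocHist ((h, a), y)) ∂(q (h.2, a)) ∂(m h) := by
    filter_upwards [hm, hFF] with h h1 h2
    rw [← h1]
    refine lintegral_congr_ae ?_
    filter_upwards [h2] with a ha
    exact lintegral_congr_ae ha
  have hmeas2 : Measurable fun z : Hist X A n × A =>
      ∫⁻ y, F₀ (snocHist (z, y)) ∂(q (z.1.2, z.2)) :=
    (hF₀.comp measurable_snocHist).lintegral_kernel_prod_right'
      (κ := q.comap (fun z : Hist X A n × A => (z.1.2, z.2)) (by fun_prop))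
  have hmeas1 : Measurable fun h : Hist X A n =>
      ∫⁻ a, ∫⁻ y, F₀ (snocHist ((h, a), y)) ∂(q (h.2, a)) ∂(m h) :=
    hmeas2.lintegral_kernel_prod_right'
  have hFi : ∫⁻ h, F h ∂(stepMeasure q L m) = ∫⁻ h, F₀ h ∂(stepMeasure q L m) :=
    lintegral_congr_ae hF.ae_eq_mk
  clear_value F₀
  rw [histInt, hL _ (hmeas1.aemeasurable.congr hin.symm), lintegral_congr_ae hin, hFi,
    stepMeasure, lintegral_map hF₀ measurable_snocHist,
    Measure.lintegral_compProd (f := fun z => F₀ (snocHist z)) (hF₀.comp measurable_snocHist),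
    Measure.lintegral_compProd]
  · rfl
  · exact hmeas2

end Histories

section InfoScheme

/-- A description of the information a class of policies may use: decisions at stage `n` are
functions of the encoded history `enc n h_n`, from which the current state can be read off and
a representative history can be recovered. -/
structure InfoScheme (X A I : Type*) [MeasurableSpace X] [MeasurableSpace A]
    [MeasurableSpace I] where
  enc : ∀ n : ℕ, Hist X A n → I
  measurable_enc : ∀ n, Measurable (enc n)
  state : I → X
  measurable_state : Measurable state
  state_enc : ∀ n h, state (enc n h) = h.2
  stage : I → ℕ
  measurable_stage : Measurable stage
  dec : ∀ n : ℕ, I → Hist X A n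
  measurable_dec : ∀ n, Measurable (dec n)
  enc_dec : ∀ n h, enc (stage (enc n h)) (dec (stage (enc n h)) (enc n h)) = enc n h

/-- A probability measure on `ℕ` charging every point. -/
def natWeight : Measure ℕ := (Measure.count : Measure ℕ).toFinite

instance isProbabilityMeasure_natWeight : IsProbabilityMeasure natWeight := by
  unfold natWeight
  infer_instance

lemma natWeight_singleton_ne_zero (n : ℕ) : natWeight {n} ≠ 0 := fun h => by
  simpa using absolutelyContinuous_toFinite (Measure.count : Measure ℕ) h

variable {X A I : Type*} [MeasurableSpace X] [MeasurableSpace A] [MeasurableSpace I]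

namespace InfoScheme

variable (φ : InfoScheme X A I)

/-- Policies whose decisions depend only on the encoded history. -/
def Adapted {Acts : X → Set A} (π : Policy Acts) : Prop :=
  ∃ m : I → Measure A, ∀ n h, π.μ n h = m (φ.enc n h)

/-- The information and the action at a given stage. -/
def infoAct (n : ℕ) (ω : Traj X A) : I × A := (φ.enc n (histMap n ω), (ω n).2)

lemma measurable_infoAct (n : ℕ) : Measurable (φ.infoAct n) :=
  ((φ.measurable_enc n).comp (measurable_histMap n)).prodMk (by fun_prop)

/-- The joint law of information and action at a random stage. -/
def mix (p : Measure (Traj X A)) : Measure (I × A) :=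
  (p.prod natWeight).map fun z => φ.infoAct z.2 z.1

lemma measurable_infoAct_uncurry : Measurable fun z : Traj X A × ℕ => φ.infoAct z.2 z.1 :=
  measurable_from_prod_countable_left fun n => φ.measurable_infoAct n

instance isProbabilityMeasure_mix (p : Measure (Traj X A)) [IsProbabilityMeasure p] :
    IsProbabilityMeasure (φ.mix p) :=
  Measure.isProbabilityMeasure_map φ.measurable_infoAct_uncurry.aemeasurable

lemma mix_eq_sum (p : Measure (Traj X A)) [IsProbabilityMeasure p] :
    φ.mix p = Measure.sum fun n => natWeight {n} • p.map (φ.infoAct n) := by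
  ext s hs
  rw [mix, Measure.map_apply φ.measurable_infoAct_uncurry hs,
    Measure.prod_apply_symm (φ.measurable_infoAct_uncurry hs), lintegral_countable',
    Measure.sum_apply _ hs]
  refine tsum_congr fun n => ?_
  rw [Measure.smul_apply, Measure.map_apply (φ.measurable_infoAct n) hs, smul_eq_mul, mul_comm]
  rfl

lemma ae_mix_iff (p : Measure (Traj X A)) [IsProbabilityMeasure p] {Q : I × A → Prop} :
    (∀ᵐ z ∂φ.mix p, Q z) ↔ ∀ n, ∀ᵐ z ∂p.map (φ.infoAct n), Q z := by
  rw [mix_eq_sum, Measure.ae_sum_iff]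
  exact forall_congr' fun n => by
    rw [Measure.ae_ennreal_smul_measure_iff (natWeight_singleton_ne_zero n)]

lemma fst_mix_eq_sum (p : Measure (Traj X A)) [IsProbabilityMeasure p] :
    (φ.mix p).fst = Measure.sum fun n =>
      natWeight {n} • (p.map (histMap n)).map (φ.enc n) := by
  rw [mix_eq_sum, Measure.fst, Measure.map_sum measurable_fst.aemeasurable]
  congr with n : 1
  rw [Measure.map_smul, Measure.map_map measurable_fst (φ.measurable_infoAct n),
    Measure.map_map (φ.measurable_enc n) (measurable_histMap n)]
  rfl

lemma ae_fst_mix (p : Measure (Traj X A)) [IsProbabilityMeasure p] {Q : I → Prop}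
    (h : ∀ᵐ i ∂(φ.mix p).fst, Q i) (n : ℕ) : ∀ᵐ h ∂p.map (histMap n), Q (φ.enc n h) := by
  rw [fst_mix_eq_sum, Measure.ae_sum_iff] at h
  have := h n
  rw [Measure.ae_ennreal_smul_measure_iff (natWeight_singleton_ne_zero n)] at this
  exact ae_of_ae_map (φ.measurable_enc n).aemeasurable this

/-- If the decisions have conditional law `M` given the information at every stage, then `M` is
the conditional law of the action given the information at a random stage. -/
lemma mix_eq_compProd (p : Measure (Traj X A)) [IsProbabilityMeasure p] (M : Kernel I A)
    [IsMarkovKernel M]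
    (h : ∀ n, p.map (fun ω => (histMap n ω, (ω n).2))
      = p.map (histMap n) ⊗ₘ M.comap (φ.enc n) (φ.measurable_enc n)) :
    φ.mix p = (φ.mix p).fst ⊗ₘ M := by
  ext s hs
  rw [Measure.compProd_apply hs, fst_mix_eq_sum, mix_eq_sum, lintegral_sum_measure,
    Measure.sum_apply _ hs]
  refine tsum_congr fun n => ?_
  have hm := M.measurable_kernel_prodMk_left hs
  have hg : Measurable fun z : Hist X A n × A => (φ.enc n z.1, z.2) :=
    ((φ.measurable_enc n).comp measurable_fst).prodMk measurable_snd
  have hf : Measurable fun ω : Traj X A => (histMap n ω, (ω n).2) :=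
    (measurable_histMap n).prodMk (by fun_prop)
  rw [lintegral_smul_measure, lintegral_map hm (φ.measurable_enc n), Measure.smul_apply,
    show φ.infoAct n = (fun z : Hist X A n × A => (φ.enc n z.1, z.2))
      ∘ fun ω => (histMap n ω, (ω n).2) from rfl,
    ← Measure.map_map hg hf, h n, Measure.map_apply hg hs, Measure.compProd_apply (hg hs)]
  rfl

end InfoScheme

end InfoScheme

section Characterization

variable {X A I : Type*} [MeasurableSpace X] [MeasurableSpace A] [MeasurableSpace I]

lemma isProbabilityMeasure_map_histMap (p : Measure (Traj X A)) [IsProbabilityMeasure p] (n : ℕ) :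
    IsProbabilityMeasure (p.map (histMap n)) :=
  Measure.isProbabilityMeasure_map (measurable_histMap n).aemeasurable

/-- The law of the initial history, for an induced strategic measure. -/
lemma Induces.map_histMap_zero {q : Kernel (X × A) X} {Acts : X → Set A} {π : Policy Acts}
    {p0 : Measure X} {p : Measure (Traj X A)} (h : Induces q π p0 p) :
    p.map (histMap 0) = p0.map fun x => (Fin.elim0, x) := by
  ext B hB
  have hm : Measurable fun x : X => ((Fin.elim0, x) : Hist X A 0) := by fun_prop
  rw [Measure.map_apply (measurable_histMap 0) hB, Measure.map_apply hm hB,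
    ← lintegral_indicator_one (hm hB)]
  exact h 0 B hB

/-- For an induced strategic measure, the iterated integrals are integrals with respect to the
laws of the histories, and these laws satisfy the one-step recursion. -/
lemma Induces.histInt_eq {q : Kernel (X × A) X} [IsMarkovKernel q] {Acts : X → Set A}
    {π : Policy Acts} {p0 : Measure X} {p : Measure (Traj X A)} [IsProbabilityMeasure p]
    (h : Induces q π p0 p) (m : ∀ n, Kernel (Hist X A n) A) [∀ n, IsMarkovKernel (m n)]
    (hm : ∀ n, ∀ᵐ h ∂p.map (histMap n), m n h = π.μ n h) (n : ℕ) :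
    (∀ F : Hist X A n → ℝ≥0∞, AEMeasurable F (p.map (histMap n)) →
      histInt p0 q π.μ n F = ∫⁻ h, F h ∂p.map (histMap n)) ∧
    p.map (histMap (n + 1)) = stepMeasure q (p.map (histMap n)) (m n) := by
  have hstep : ∀ n, (∀ F : Hist X A n → ℝ≥0∞, AEMeasurable F (p.map (histMap n)) →
      histInt p0 q π.μ n F = ∫⁻ h, F h ∂p.map (histMap n)) →
      p.map (histMap (n + 1)) = stepMeasure q (p.map (histMap n)) (m n) := by
    intro n hn
    ext B hB
    rw [Measure.map_apply (measurable_histMap _) hB, ← lintegral_indicator_one hB]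
    refine (h (n + 1) B hB).trans (histInt_succ_eq q (hm n) hn ?_)
    exact (measurable_const.indicator hB).aemeasurable
  have hInt : ∀ F : Hist X A n → ℝ≥0∞, AEMeasurable F (p.map (histMap n)) →
      histInt p0 q π.μ n F = ∫⁻ h, F h ∂p.map (histMap n) := by
    induction n with
    | zero =>
      intro F hF
      rw [h.map_histMap_zero] at hF ⊢
      rw [lintegral_map' hF (by fun_prop)]
      rfl
    | succ n ih =>
      intro F hF
      rw [hstep n ih] at hF ⊢
      exact histInt_succ_eq q (hm n) ih hF
  exact ⟨hInt, hstep n hInt⟩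

namespace InfoScheme

variable (φ : InfoScheme X A I)

lemma exists_policy_kernel [StandardBorelSpace A] [Nonempty A] {q : Kernel (X × A) X}
    [IsMarkovKernel q] {Acts : X → Set A} {π : Policy Acts} (hπ : φ.Adapted π)
    {p0 : Measure X} {p : Measure (Traj X A)} [IsProbabilityMeasure p]
    (h : Induces q π p0 p) {K : Kernel I A} [IsMarkovKernel K]
    (hK : φ.mix p = (φ.mix p).fst ⊗ₘ K) :
    (∀ n, p.map (histMap (n + 1))
      = stepMeasure q (p.map (histMap n)) (K.comap (φ.enc n) (φ.measurable_enc n))) ∧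
    ∀ n, ∀ᵐ h ∂p.map (histMap n), K (φ.enc n h) = π.μ n h := by
  have hLp := isProbabilityMeasure_map_histMap p
  let m : I → Measure A := fun i => π.μ (φ.stage i) (φ.dec (φ.stage i) i)
  have hm : ∀ n h, m (φ.enc n h) = π.μ n h := by
    obtain ⟨m', hm'⟩ := hπ
    intro n h
    rw [hm' n h, ← φ.enc_dec n h, ← hm', φ.enc_dec n h]
  have hmp : ∀ i, IsProbabilityMeasure (m i) := fun i => π.isProb _ _
  have hae : ∀ B, MeasurableSet B → AEMeasurable (fun i => m i B) (φ.mix p).fst := by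
    intro B hB
    refine NullMeasurable.aemeasurable fun E hE => ?_
    have hU : (fun i => m i B) ⁻¹' E
        = ⋃ n, φ.stage ⁻¹' {n} ∩ φ.dec n ⁻¹' ((fun h => π.μ n h B) ⁻¹' E) := by
      ext i
      simp [m]
    rw [hU]
    refine NullMeasurableSet.iUnion fun n => ?_
    refine (φ.measurable_stage (measurableSet_singleton n)).nullMeasurableSet.inter ?_
    have hP : IsProbabilityMeasure ((φ.mix p).fst.map (φ.dec n)) :=
      Measure.isProbabilityMeasure_map (φ.measurable_dec n).aemeasurable
    exact (π.umeas n B hB E hE _ hP).preimage ((φ.measurable_dec n).quasiMeasurePreserving _)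
  obtain ⟨M, hM, hMm⟩ := exists_kernel_ae_eq (φ.mix p).fst m hmp hae
  have hMn : ∀ n, ∀ᵐ h ∂p.map (histMap n),
      M.comap (φ.enc n) (φ.measurable_enc n) h = π.μ n h := by
    intro n
    filter_upwards [φ.ae_fst_mix p hMm n] with h hh
    rw [Kernel.comap_apply, hh, hm]
  have hrec := fun n => (h.histInt_eq (fun n => M.comap (φ.enc n) (φ.measurable_enc n)) hMn n).2
  have hMmix : φ.mix p = (φ.mix p).fst ⊗ₘ M := by
    refine φ.mix_eq_compProd p M fun n => ?_
    rw [← map_unsnocHist_stepMeasure q, ← hrec n,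
      Measure.map_map measurable_unsnocHist (measurable_histMap _)]
    rfl
  have hMK : M =ᵐ[(φ.mix p).fst] K := Kernel.ae_eq_of_compProd_eq (hMmix.symm.trans hK)
  have hMKn : ∀ n, ∀ᵐ h ∂p.map (histMap n), M (φ.enc n h) = K (φ.enc n h) :=
    fun n => φ.ae_fst_mix p hMK n
  refine ⟨fun n => (hrec n).trans (stepMeasure_congr q (hMKn n)), fun n => ?_⟩
  filter_upwards [hMKn n, hMn n] with h h1 h2
  rw [← h1, ← h2, Kernel.comap_apply]

/-- Trajectories of a consistent process almost surely satisfy the constraint. -/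
lemma ae_mem_graph {q : Kernel (X × A) X} [IsMarkovKernel q] {Acts : X → Set A}
    (π : Policy Acts) {p : Measure (Traj X A)} [IsProbabilityMeasure p] {K : Kernel I A}
    [IsMarkovKernel K] (n : ℕ) (hstep : p.map (histMap (n + 1))
      = stepMeasure q (p.map (histMap n)) (K.comap (φ.enc n) (φ.measurable_enc n)))
    (hK : ∀ᵐ h ∂p.map (histMap n), K (φ.enc n h) = π.μ n h)
    (hΓ : NullMeasurableSet {xa : X × A | xa.2 ∈ Acts xa.1} (p.map fun ω => ω n)) :
    ∀ᵐ ω ∂p, (ω n).2 ∈ Acts (ω n).1 := by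
  have hLp := isProbabilityMeasure_map_histMap p
  set Γ : Set (X × A) := {xa : X × A | xa.2 ∈ Acts xa.1} with hΓdef
  have hev : Measurable fun ω : Traj X A => ω n := measurable_pi_apply n
  have hg : Measurable fun z : Hist X A n × A => (z.1.2, z.2) := by fun_prop
  have hlaw : (p.map fun ω => ω n)
      = (p.map (histMap n) ⊗ₘ K.comap (φ.enc n) (φ.measurable_enc n)).map
        fun z => (z.1.2, z.2) := by
    rw [← map_unsnocHist_stepMeasure q, ← hstep,
      Measure.map_map measurable_unsnocHist (measurable_histMap _),
      Measure.map_map hg (measurable_unsnocHist.comp (measurable_histMap _))]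
    rfl
  have hPn : IsProbabilityMeasure (p.map fun ω => ω n) :=
    Measure.isProbabilityMeasure_map hev.aemeasurable
  have hone : (p.map fun ω => ω n) Γ = 1 := by
    rw [← measure_toMeasurable]
    set N := toMeasurable (p.map fun ω => ω n) Γ with hN
    have hNm : MeasurableSet N := measurableSet_toMeasurable _ _
    rw [hlaw, Measure.map_apply hg hNm, Measure.compProd_apply (hg hNm)]
    have : ∀ᵐ h ∂p.map (histMap n), K.comap (φ.enc n) (φ.measurable_enc n) h
        (Prod.mk h ⁻¹' ((fun z : Hist X A n × A => (z.1.2, z.2)) ⁻¹' N)) = 1 := by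
      filter_upwards [hK] with h hh
      refine le_antisymm prob_le_one ?_
      rw [Kernel.comap_apply, hh, ← π.feasible n h]
      refine measure_mono fun a ha => ?_
      exact subset_toMeasurable (p.map fun ω => ω n) Γ (show (h.2, a) ∈ Γ from ha)
    rw [lintegral_congr_ae this, lintegral_one, measure_univ]
  have hc : (p.map fun ω => ω n) Γᶜ = 0 := by
    rw [prob_compl_eq_zero_iff₀ hΓ, hone]
  rw [Measure.map_apply₀ hev.aemeasurable hΓ.compl] at hc
  exact hc

end InfoScheme

end Characterization

section Construction

variable {X A I : Type*} [MeasurableSpace X] [MeasurableSpace A] [MeasurableSpace I]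

/-- The policy following a kernel `K` on a measurable set `G` of encoded histories, and a
selector `s` elsewhere. -/
def InfoScheme.patchedPolicy (φ : InfoScheme X A I) {Acts : X → Set A} (K : Kernel I A)
    [IsMarkovKernel K] {G : Set I} (hG : MeasurableSet G)
    (hGK : ∀ i ∈ G, K i (Acts (φ.state i)) = 1) {s : X → A} (hs : ∀ x, s x ∈ Acts x)
    (hsm : ∀ (μ : Measure X) [IsFiniteMeasure μ], AEMeasurable s μ) : Policy Acts := by
  classical
  exact
  { μ := fun n h => if φ.enc n h ∈ G then K (φ.enc n h) else Measure.dirac (s h.2)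
    isProb := fun n h => by
      split_ifs
      · infer_instance
      · infer_instance
    umeas := fun n B hB E hE μ hμ => by
      have hG' : MeasurableSet (φ.enc n ⁻¹' G) := φ.measurable_enc n hG
      have hsn : AEMeasurable (fun h : Hist X A n => s h.2) μ :=
        (hsm (μ.map Prod.snd)).comp_aemeasurable measurable_snd.aemeasurable
      have h1 : AEMeasurable (fun h => (φ.enc n ⁻¹' G).indicator
          (fun h => K (φ.enc n h) B) h + (φ.enc n ⁻¹' G)ᶜ.indicator
          (fun h => B.indicator (fun _ => (1 : ℝ≥0∞)) (s h.2)) h) μ := by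
        refine AEMeasurable.add ?_ ?_
        · exact (((K.measurable_coe hB).comp (φ.measurable_enc n)).indicator hG').aemeasurable
        · exact (((measurable_const.indicator hB).comp_aemeasurable hsn)).indicator hG'.compl
      have h2 : (fun h : Hist X A n => (if φ.enc n h ∈ G then K (φ.enc n h)
          else Measure.dirac (s h.2)) B) = fun h => (φ.enc n ⁻¹' G).indicator
          (fun h => K (φ.enc n h) B) h + (φ.enc n ⁻¹' G)ᶜ.indicator
          (fun h => B.indicator (fun _ => (1 : ℝ≥0∞)) (s h.2)) h := by
        ext h
        by_cases hh : φ.enc n h ∈ G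
        · simp [hh]
        · simp [hh, Measure.dirac_apply' _ hB, Set.indicator]
      rw [h2]
      exact h1.nullMeasurable hE
    feasible := fun n h => by
      split_ifs with hh
      · rw [← hGK _ hh, φ.state_enc]
      · exact Measure.dirac_apply_of_mem (hs _) }

lemma InfoScheme.patchedPolicy_μ (φ : InfoScheme X A I) {Acts : X → Set A} (K : Kernel I A)
    [IsMarkovKernel K] {G : Set I} (hG : MeasurableSet G)
    (hGK : ∀ i ∈ G, K i (Acts (φ.state i)) = 1) {s : X → A} (hs : ∀ x, s x ∈ Acts x)
    (hsm : ∀ (μ : Measure X) [IsFiniteMeasure μ], AEMeasurable s μ) [DecidablePred (· ∈ G)]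
    (n : ℕ) (h : Hist X A n) :
    (φ.patchedPolicy K hG hGK hs hsm).μ n h
      = if φ.enc n h ∈ G then K (φ.enc n h) else Measure.dirac (s h.2) := by
  unfold patchedPolicy
  simp only
  congr

/-- A process satisfying the one-step recursion for the decisions of a policy is induced by it. -/
lemma induces_of_step {q : Kernel (X × A) X} [IsMarkovKernel q] {Acts : X → Set A}
    (π : Policy Acts) {p : Measure (Traj X A)} [IsProbabilityMeasure p]
    (m : ∀ n, Kernel (Hist X A n) A) [∀ n, IsMarkovKernel (m n)]
    (hm : ∀ n, ∀ᵐ h ∂p.map (histMap n), m n h = π.μ n h)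
    (hstep : ∀ n, p.map (histMap (n + 1)) = stepMeasure q (p.map (histMap n)) (m n)) :
    Induces q π (p.map fun ω => (ω 0).1) p := by
  have hLp := isProbabilityMeasure_map_histMap p
  have hInt : ∀ n, ∀ F : Hist X A n → ℝ≥0∞, AEMeasurable F (p.map (histMap n)) →
      histInt (p.map fun ω => (ω 0).1) q π.μ n F = ∫⁻ h, F h ∂p.map (histMap n) := by
    intro n
    induction n with
    | zero =>
      intro F hF
      have h0 : p.map (histMap 0)
          = (p.map fun ω => (ω 0).1).map fun x => ((Fin.elim0, x) : Hist X A 0) := by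
        rw [Measure.map_map (by fun_prop) (by fun_prop)]
        congr 1
        ext ω : 1
        exact Prod.ext (Subsingleton.elim _ _) rfl
      rw [h0] at hF ⊢
      rw [lintegral_map' hF (by fun_prop)]
      rfl
    | succ n ih =>
      intro F hF
      rw [hstep n] at hF ⊢
      exact histInt_succ_eq q (hm n) ih hF
  intro n B hB
  rw [hInt n _ (measurable_const.indicator hB).aemeasurable]
  exact ((lintegral_indicator_one hB).trans
    (Measure.map_apply (measurable_histMap n) hB)).symm

lemma InfoScheme.exists_policy [StandardBorelSpace A] (φ : InfoScheme X A I)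
    {q : Kernel (X × A) X} [IsMarkovKernel q] {Acts : X → Set A} {p : Measure (Traj X A)}
    [IsProbabilityMeasure p] {K : Kernel I A} [IsMarkovKernel K]
    (hK : φ.mix p = (φ.mix p).fst ⊗ₘ K)
    (hstep : ∀ n, p.map (histMap (n + 1))
      = stepMeasure q (p.map (histMap n)) (K.comap (φ.enc n) (φ.measurable_enc n)))
    (hΓ : ∀ (μ : Measure (X × A)) [IsFiniteMeasure μ],
      NullMeasurableSet {xa : X × A | xa.2 ∈ Acts xa.1} μ)
    (hp : ∀ᵐ ω ∂p, ∀ n, (ω n).2 ∈ Acts (ω n).1)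
    {s : X → A} (hs : ∀ x, s x ∈ Acts x)
    (hsm : ∀ (μ : Measure X) [IsFiniteMeasure μ], AEMeasurable s μ) (d : Prop)
    (hd : d → ∀ᵐ i ∂(φ.mix p).fst, ∃ a, K i = Measure.dirac a) :
    ∃ π : Policy Acts, (φ.Adapted π ∧ (d → π.Nonrandomized)) ∧
      Induces q π (p.map fun ω => (ω 0).1) p := by
  have hst : Measurable fun z : I × A => (φ.state z.1, z.2) :=
    (φ.measurable_state.comp measurable_fst).prodMk measurable_snd
  have hmix : ∀ᵐ z ∂φ.mix p, z.2 ∈ Acts (φ.state z.1) := by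
    rw [φ.ae_mix_iff]
    intro n
    have hnull : NullMeasurableSet {z : I × A | z.2 ∈ Acts (φ.state z.1)}
        (p.map (φ.infoAct n)) := by
      have := Measure.isProbabilityMeasure_map (μ := p) (φ.measurable_infoAct n).aemeasurable
      exact (hΓ ((p.map (φ.infoAct n)).map fun z => (φ.state z.1, z.2))).preimage
        (hst.quasiMeasurePreserving _)
    change p.map (φ.infoAct n) {z : I × A | z.2 ∈ Acts (φ.state z.1)}ᶜ = 0
    rw [Measure.map_apply₀ (φ.measurable_infoAct n).aemeasurable hnull.compl]
    refine measure_mono_null ?_ hp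
    intro ω hω hall
    refine hω ?_
    change (ω n).2 ∈ Acts (φ.state (φ.enc n (histMap n ω)))
    rw [φ.state_enc]
    exact hall n
  obtain ⟨Γ₀, hΓ₀, hΓ₀m, hΓ₀s⟩ := hmix.exists_measurable_mem
  have hsec : ∀ᵐ i ∂(φ.mix p).fst, K i (Prod.mk i ⁻¹' Γ₀) = 1 := by
    have h1 : ∀ᵐ z ∂(φ.mix p).fst ⊗ₘ K, z ∈ Γ₀ := by rwa [← hK]
    filter_upwards [Measure.ae_ae_of_ae_compProd h1] with i hi
    exact (mem_ae_iff_prob_eq_one (measurable_prodMk_left hΓ₀m)).1 hi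
  classical
  let G : Set I := {i | K i (Prod.mk i ⁻¹' Γ₀) = 1} ∩ {i | d → ∃ a, K i = Measure.dirac a}
  have hG : MeasurableSet G := by
    refine (measurableSet_eq_fun (K.measurable_kernel_prodMk_left hΓ₀m) measurable_const).inter ?_
    by_cases h : d
    · simpa [h] using measurableSet_eq_dirac K
    · simp [h]
  have hGae : ∀ᵐ i ∂(φ.mix p).fst, i ∈ G := by
    by_cases h : d
    · filter_upwards [hsec, hd h] with i h1 h2 using ⟨h1, fun _ => h2⟩
    · filter_upwards [hsec] with i h1 using ⟨h1, fun h' => absurd h' h⟩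
  have hGK : ∀ i ∈ G, K i (Acts (φ.state i)) = 1 := fun i hi =>
    le_antisymm prob_le_one (hi.1.symm.le.trans (measure_mono fun a ha => hΓ₀s _ ha))
  refine ⟨φ.patchedPolicy K hG hGK hs hsm, ⟨⟨fun i => if i ∈ G then K i else
    Measure.dirac (s (φ.state i)), fun n h => ?_⟩, fun h n hh => ?_⟩,
    induces_of_step _ (fun n => K.comap (φ.enc n) (φ.measurable_enc n)) (fun n => ?_) hstep⟩
  · rw [φ.patchedPolicy_μ]
    simp only [φ.state_enc]
  · rw [φ.patchedPolicy_μ]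
    split_ifs with hi
    · exact hi.2 h
    · exact ⟨_, rfl⟩
  · filter_upwards [φ.ae_fst_mix p hGae n] with h hh
    rw [φ.patchedPolicy_μ, if_pos hh, Kernel.comap_apply]

end Construction

section ParametrizedKernels

variable {Y : Type*} [TopologicalSpace Y] [PolishSpace Y] [MeasurableSpace Y] [BorelSpace Y]

/-- The tautological kernel from probability measures on `Y` to `Y`. -/
def probKernel (Y : Type*) [TopologicalSpace Y] [PolishSpace Y] [MeasurableSpace Y]
    [BorelSpace Y] : Kernel (ProbabilityMeasure Y) Y :=
  ⟨fun p => p.toMeasure, measurable_toMeasure⟩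

lemma probKernel_apply (p : ProbabilityMeasure Y) : probKernel Y p = p.toMeasure := rfl

instance isMarkovKernel_probKernel : IsMarkovKernel (probKernel Y) :=
  ⟨fun p => p.2⟩

lemma measurableSet_concentrated {T : Set Y} (hT : MeasurableSet T) :
    MeasurableSet {p : ProbabilityMeasure Y | ∀ᵐ ω ∂p.toMeasure, ω ∈ T} :=
  measurableSet_eq_fun ((probKernel Y).measurable_coe hT.compl) measurable_const

end ParametrizedKernels

section StepKernel

variable {X A Z : Type*} [MeasurableSpace X] [MeasurableSpace A] [MeasurableSpace Z]

/-- The one-step laws, as a kernel in the law of the process and the decision kernel. -/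
def stepKernel (q : Kernel (X × A) X) {n : ℕ}
    (L : Kernel Z (Hist X A n)) (m : Kernel (Z × Hist X A n) A) : Kernel Z (Hist X A (n + 1)) :=
  ((L ⊗ₖ m) ⊗ₖ q.comap (fun z : Z × (Hist X A n × A) => (z.2.1.2, z.2.2)) (by fun_prop)).map
    snocHist

instance isMarkovKernel_stepKernel (q : Kernel (X × A) X)
    [IsMarkovKernel q] {n : ℕ} (L : Kernel Z (Hist X A n)) [IsMarkovKernel L]
    (m : Kernel (Z × Hist X A n) A) [IsMarkovKernel m] : IsMarkovKernel (stepKernel q L m) :=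
  Kernel.IsMarkovKernel.map _ measurable_snocHist

lemma stepKernel_apply (q : Kernel (X × A) X)
    [IsMarkovKernel q] {n : ℕ} (L : Kernel Z (Hist X A n)) [IsMarkovKernel L]
    (m : Kernel (Z × Hist X A n) A) [IsMarkovKernel m] (z : Z) :
    stepKernel q L m z = stepMeasure q (L z) (m.sectR z) := by
  rw [stepKernel, Kernel.map_apply _ measurable_snocHist,
    Kernel.compProd_apply_eq_compProd_sectR, Kernel.compProd_apply_eq_compProd_sectR]
  rfl

end StepKernel

lemma measurableSet_feasible {X A : Type*} [MeasurableSpace X] [MeasurableSpace A]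
    {Acts : X → Set A} (hΓ : MeasurableSet {xa : X × A | xa.2 ∈ Acts xa.1}) :
    MeasurableSet {ω : Traj X A | ∀ n, (ω n).2 ∈ Acts (ω n).1} := by
  rw [Set.ofPred_forall]
  exact MeasurableSet.iInter fun n => hΓ.preimage (measurable_pi_apply n)

lemma analyticSet_feasible {X A : Type*} [TopologicalSpace X] [PolishSpace X]
    [TopologicalSpace A] [PolishSpace A] {Acts : X → Set A}
    (hΓ : AnalyticSet {xa : X × A | xa.2 ∈ Acts xa.1}) :
    AnalyticSet {ω : Traj X A | ∀ n, (ω n).2 ∈ Acts (ω n).1} := by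
  rw [Set.ofPred_forall]
  exact AnalyticSet.iInter fun n => hΓ.preimage (continuous_apply n)

section StrategicMeasures

variable {X A I : Type*} [TopologicalSpace X] [PolishSpace X] [MeasurableSpace X] [BorelSpace X]
  [TopologicalSpace A] [PolishSpace A] [MeasurableSpace A] [BorelSpace A] [MeasurableSpace I]

namespace InfoScheme

variable (φ : InfoScheme X A I)

/-- The mixed law of information and action, as a kernel in the strategic measure. -/
def mixKernel : Kernel (ProbabilityMeasure (Traj X A)) (I × A) :=
  (probKernel (Traj X A) ×ₖ Kernel.const _ natWeight).map fun z => φ.infoAct z.2 z.1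

instance isMarkovKernel_mixKernel : IsMarkovKernel φ.mixKernel :=
  Kernel.IsMarkovKernel.map _ φ.measurable_infoAct_uncurry

lemma mixKernel_apply (p : ProbabilityMeasure (Traj X A)) :
    φ.mixKernel p = φ.mix p.toMeasure := by
  rw [mixKernel, Kernel.map_apply _ φ.measurable_infoAct_uncurry, Kernel.prod_apply,
    Kernel.const_apply, probKernel_apply, mix]

lemma measurableSet_step (q : Kernel (X × A) X) [IsMarkovKernel q]
    (K : Kernel (ProbabilityMeasure (Traj X A) × I) A) [IsMarkovKernel K] :
    MeasurableSet {p : ProbabilityMeasure (Traj X A) | ∀ n, p.toMeasure.map (histMap (n + 1))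
      = stepMeasure q (p.toMeasure.map (histMap n))
        ((K.sectR p).comap (φ.enc n) (φ.measurable_enc n))} := by
  rw [Set.ofPred_forall]
  refine MeasurableSet.iInter fun n => ?_
  have hL : ∀ n, IsMarkovKernel ((probKernel (Traj X A)).map (histMap n)) :=
    fun n => Kernel.IsMarkovKernel.map _ (measurable_histMap n)
  have hg : Measurable fun z : ProbabilityMeasure (Traj X A) × Hist X A n =>
      (z.1, φ.enc n z.2) :=
    measurable_fst.prodMk ((φ.measurable_enc n).comp measurable_snd)
  convert measurableSet_kernel_eq ((probKernel (Traj X A)).map (histMap (n + 1)))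
    (stepKernel q ((probKernel (Traj X A)).map (histMap n)) (K.comap _ hg)) using 3 with p
  rw [stepKernel_apply, Kernel.map_apply _ (measurable_histMap _),
    Kernel.map_apply _ (measurable_histMap _)]
  rfl

lemma measurableSet_dirac (K : Kernel (ProbabilityMeasure (Traj X A) × I) A) [IsMarkovKernel K]
    (d : Prop) :
    MeasurableSet {p : ProbabilityMeasure (Traj X A) |
      d → ∀ᵐ i ∂(φ.mix p.toMeasure).fst, ∃ a, K.sectR p i = Measure.dirac a} := by
  by_cases h : d
  · simp only [h, true_imp_iff]
    have hm := Kernel.measurable_kernel_prodMk_left (κ := φ.mixKernel.fst)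
      (measurableSet_eq_dirac K).compl
    convert measurableSet_eq_fun hm (measurable_const (a := (0 : ℝ≥0∞))) using 3 with p
    rw [Kernel.fst_apply, mixKernel_apply]
    rfl
  · simp [h]

variable [MeasurableSpace.CountablyGenerated I]

/-- Strategic measures of a class of policies adapted to an information scheme are those
consistent with a universal Borel disintegration. -/
lemma sOf_eq [Nonempty A] (q : Kernel (X × A) X) [IsMarkovKernel q] {Acts : X → Set A}
    (hne : ∀ x, (Acts x).Nonempty) (hΓ : AnalyticSet {xa : X × A | xa.2 ∈ Acts xa.1})
    (d : Prop) :
    ∃ B : Set (ProbabilityMeasure (Traj X A)), MeasurableSet B ∧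
      SOf q Acts (fun π => φ.Adapted π ∧ (d → π.Nonrandomized))
        = {p | p ∈ B ∧ ∀ᵐ ω ∂p.toMeasure, ω ∈ {ω : Traj X A | ∀ n, (ω n).2 ∈ Acts (ω n).1}} := by
  let K : Kernel (ProbabilityMeasure (Traj X A) × I) A := φ.mixKernel.condKernel
  have hKm : IsMarkovKernel K := Kernel.instIsMarkovKernelCondKernel φ.mixKernel
  have hK : ∀ p : ProbabilityMeasure (Traj X A),
      φ.mix p.toMeasure = (φ.mix p.toMeasure).fst ⊗ₘ K.sectR p := by
    intro p
    rw [← mixKernel_apply, Measure.fst, ← Kernel.fst_apply,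
      ← Kernel.compProd_apply_eq_compProd_sectR, Kernel.disintegrate]
  have hnull : ∀ (μ : Measure (X × A)) [IsFiniteMeasure μ],
      NullMeasurableSet {xa : X × A | xa.2 ∈ Acts xa.1} μ :=
    fun μ _ => nullMeasurableSet_of_analyticSet hΓ μ
  refine ⟨_, (φ.measurableSet_step q K).inter (φ.measurableSet_dirac K d), ?_⟩
  ext p
  constructor
  · rintro ⟨π, p0, ⟨hπ, hd⟩, hind⟩
    obtain ⟨hstep, hKπ⟩ := φ.exists_policy_kernel hπ hind (hK p)
    refine ⟨⟨hstep, fun h => ?_⟩, ae_all_iff.2 fun n => ?_⟩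
    · rw [φ.fst_mix_eq_sum, Measure.ae_sum_iff]
      intro n
      rw [Measure.ae_ennreal_smul_measure_iff (natWeight_singleton_ne_zero n),
        ae_map_iff (φ.measurable_enc n).aemeasurable (measurableSet_eq_dirac (K.sectR p))]
      filter_upwards [hKπ n] with x hx
      rw [hx]
      exact hd h n x
    · have := Measure.isProbabilityMeasure_map (μ := p.toMeasure)
        (measurable_pi_apply (X := fun _ : ℕ => X × A) n).aemeasurable
      exact φ.ae_mem_graph π n (hstep n) (hKπ n) (hnull _)
  · rintro ⟨⟨hstep, hd⟩, hp⟩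
    obtain ⟨s, hs, hsm⟩ := exists_selector hne hΓ
    obtain ⟨π, hπ, hind⟩ := φ.exists_policy (hK p) hstep hnull hp hs hsm d hd
    have h0 : Measurable fun ω : Traj X A => (ω 0).1 := by fun_prop
    exact ⟨π, ⟨_, Measure.isProbabilityMeasure_map h0.aemeasurable⟩, hπ, hind⟩

lemma analyticSet_sOf [Nonempty A] (q : Kernel (X × A) X) [IsMarkovKernel q] {Acts : X → Set A}
    (hne : ∀ x, (Acts x).Nonempty) (hΓ : AnalyticSet {xa : X × A | xa.2 ∈ Acts xa.1})
    (d : Prop) : AnalyticSet (SOf q Acts fun π => φ.Adapted π ∧ (d → π.Nonrandomized)) := by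
  obtain ⟨B, hB, h⟩ := φ.sOf_eq q hne hΓ d
  rw [h]
  exact analyticSet_concentrated (analyticSet_feasible hΓ) hB

lemma measurableSet_sOf [Nonempty A] (q : Kernel (X × A) X) [IsMarkovKernel q]
    {Acts : X → Set A} (hne : ∀ x, (Acts x).Nonempty)
    (hΓ : MeasurableSet {xa : X × A | xa.2 ∈ Acts xa.1}) (d : Prop) :
    MeasurableSet (SOf q Acts fun π => φ.Adapted π ∧ (d → π.Nonrandomized)) := by
  obtain ⟨B, hB, h⟩ := φ.sOf_eq q hne hΓ.analyticSet d
  rw [h]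
  exact hB.inter (measurableSet_concentrated (measurableSet_feasible hΓ))

end InfoScheme

end StrategicMeasures

section Schemes

variable {X A : Type*} [MeasurableSpace X] [MeasurableSpace A]

/-- The scheme remembering the whole history, padded to an infinite sequence. -/
def fullScheme (z₀ : X × A) : InfoScheme X A (ℕ × Traj X A × X) where
  enc n h := (n, (fun k => if hk : k < n then h.1 ⟨k, hk⟩ else z₀), h.2)
  measurable_enc n := by
    refine measurable_const.prodMk ((measurable_pi_iff.2 fun k => ?_).prodMk measurable_snd)
    split_ifs with hk
    · fun_prop
    · fun_prop
  state i := i.2.2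
  measurable_state := by fun_prop
  state_enc _ _ := rfl
  stage i := i.1
  measurable_stage := by fun_prop
  dec n i := (fun k => i.2.1 k, i.2.2)
  measurable_dec n := by fun_prop
  enc_dec n h := by
    refine Prod.ext rfl (Prod.ext (funext fun k => ?_) rfl)
    by_cases hk : k < n
    · simp [hk]
    · simp [hk]

/-- The scheme remembering the stage and the current state. -/
def markovScheme (X : Type*) {A : Type*} [MeasurableSpace X] [MeasurableSpace A] (a₀ : A) :
    InfoScheme X A (ℕ × X) where
  enc n h := (n, h.2)
  measurable_enc n := by fun_prop
  state i := i.2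
  measurable_state := by fun_prop
  state_enc _ _ := rfl
  stage i := i.1
  measurable_stage := by fun_prop
  dec n i := (fun _ => (i.2, a₀), i.2)
  measurable_dec n := by fun_prop
  enc_dec _ _ := rfl

/-- The scheme remembering the current state only. -/
def stationaryScheme (X : Type*) {A : Type*} [MeasurableSpace X] [MeasurableSpace A] (a₀ : A) :
    InfoScheme X A X where
  enc n h := h.2
  measurable_enc n := by fun_prop
  state i := i
  measurable_state := measurable_id
  state_enc _ _ := rfl
  stage _ := 0
  measurable_stage := measurable_const
  dec n i := (fun _ => (i, a₀), i)
  measurable_dec n := by fun_prop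
  enc_dec _ _ := rfl

lemma adapted_fullScheme (z₀ : X × A) {Acts : X → Set A} (π : Policy Acts) :
    (fullScheme z₀).Adapted π :=
  ⟨fun i => π.μ i.1 (fun k => i.2.1 k, i.2.2), fun n h => by simp [fullScheme]⟩

lemma adapted_markovScheme_iff (a₀ : A) {Acts : X → Set A} (π : Policy Acts) :
    (markovScheme X a₀).Adapted π ↔ π.Markov :=
  ⟨fun ⟨m, hm⟩ => ⟨fun n x => m (n, x), hm⟩, fun ⟨m, hm⟩ => ⟨fun i => m i.1 i.2, hm⟩⟩

lemma adapted_stationaryScheme_iff (a₀ : A) {Acts : X → Set A} (π : Policy Acts) :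
    (stationaryScheme X a₀).Adapted π ↔ π.Stationary :=
  Iff.rfl

end Schemes

/-- Theorem `thm-strat-m`: for each `S_⋆ ∈ {S, S_m, S_s}`, the set `S_⋆`
and its subset `S'_⋆` of strategic measures induced by nonrandomized policies are analytic
subsets of `P(Ω)`; moreover, if the constraint graph `Γ` is Borel, they are Borel. -/
theorem statement0
    {X A : Type*} [TopologicalSpace X] [PolishSpace X] [MeasurableSpace X] [BorelSpace X]
    [TopologicalSpace A] [PolishSpace A] [MeasurableSpace A] [BorelSpace A]
    (q : Kernel (X × A) X) [IsMarkovKernel q] (Acts : X → Set A)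
    (hne : ∀ x, (Acts x).Nonempty)
    (hΓ : MeasureTheory.AnalyticSet {xa : X × A | xa.2 ∈ Acts xa.1}) :
    (MeasureTheory.AnalyticSet (SOf q Acts fun _ => True) ∧
     MeasureTheory.AnalyticSet (SOf q Acts Policy.Nonrandomized) ∧
     MeasureTheory.AnalyticSet (SOf q Acts Policy.Markov) ∧
     MeasureTheory.AnalyticSet (SOf q Acts fun π => π.Markov ∧ π.Nonrandomized) ∧
     MeasureTheory.AnalyticSet (SOf q Acts Policy.Stationary) ∧
     MeasureTheory.AnalyticSet (SOf q Acts fun π => π.Stationary ∧ π.Nonrandomized)) ∧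
    (MeasurableSet {xa : X × A | xa.2 ∈ Acts xa.1} →
     MeasurableSet (SOf q Acts fun _ => True) ∧
     MeasurableSet (SOf q Acts Policy.Nonrandomized) ∧
     MeasurableSet (SOf q Acts Policy.Markov) ∧
     MeasurableSet (SOf q Acts fun π => π.Markov ∧ π.Nonrandomized) ∧
     MeasurableSet (SOf q Acts Policy.Stationary) ∧
     MeasurableSet (SOf q Acts fun π => π.Stationary ∧ π.Nonrandomized)) := by
  cases isEmpty_or_nonempty X with
  | inl hX =>
    have hempty : ∀ S : Set (ProbabilityMeasure (Traj X A)), S = ∅ := fun S =>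
      Set.eq_empty_of_forall_notMem fun p _ =>
        (p.toMeasure.nonempty_of_neZero).elim fun ω => hX.elim (ω 0).1
    simp only [hempty, analyticSet_empty, MeasurableSet.empty, and_self, imp_true_iff]
  | inr hX =>
    obtain ⟨x₀⟩ := hX
    obtain ⟨a₀, -⟩ := hne x₀
    have hA : Nonempty A := ⟨a₀⟩
    have h1 := (fullScheme (x₀, a₀)).analyticSet_sOf q hne hΓ
    have h2 := (markovScheme X a₀).analyticSet_sOf q hne hΓ
    have h3 := (stationaryScheme X a₀).analyticSet_sOf q hne hΓ
    simp only [adapted_fullScheme, adapted_markovScheme_iff, adapted_stationaryScheme_iff,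
      true_and] at h1 h2 h3
    refine ⟨⟨?_, ?_, ?_, ?_, ?_, ?_⟩, fun hB => ?_⟩
    · simpa using h1 False
    · simpa using h1 True
    · simpa using h2 False
    · simpa using h2 True
    · simpa using h3 False
    · simpa using h3 True
    have h1 := (fullScheme (x₀, a₀)).measurableSet_sOf q hne hB
    have h2 := (markovScheme X a₀).measurableSet_sOf q hne hB
    have h3 := (stationaryScheme X a₀).measurableSet_sOf q hne hB
    simp only [adapted_fullScheme, adapted_markovScheme_iff, adapted_stationaryScheme_iff,
      true_and] at h1 h2 h3
    refine ⟨?_, ?_, ?_, ?_, ?_, ?_⟩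
    · simpa using h1 False
    · simpa using h1 True
    · simpa using h2 False
    · simpa using h2 True
    · simpa using h3 False
    · simpa using h3 True

end PaperStmt
end
end

section
/- For each S_⋆ ∈ {S, S_m, S_s}, the sets tilde-S_⋆ and tilde-S'_⋆ are analytic subsets of 𝕏 × P(Ω); moreover, if the constraint graph Γ is Borel, they are Borel subsets of 𝕏 × P(Ω). -/
open MeasureTheory ProbabilityTheory Filter
open scoped ENNReal NNReal Topology

noncomputable section

namespace PaperStmt

/-! ### Universally measurable sets -/

lemma UniversallyMeasurableSet.of_measurableSet {α : Type*} [MeasurableSpace α] {s : Set α}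
    (hs : MeasurableSet s) : UniversallyMeasurableSet s :=
  fun _ _ => hs.nullMeasurableSet

lemma UniversallyMeasurableSet.preimage {α β : Type*} [MeasurableSpace α] [MeasurableSpace β]
    {s : Set β} (hs : UniversallyMeasurableSet s) {f : α → β} (hf : Measurable f) :
    UniversallyMeasurableSet (f ⁻¹' s) := fun μ _ =>
  (hs (μ.map f) (Measure.isProbabilityMeasure_map hf.aemeasurable)).preimage
    (hf.measurePreserving μ).quasiMeasurePreserving

/-- The σ-algebra of universally measurable sets. -/
@[reducible]
def universalSpace (α : Type*) [MeasurableSpace α] : MeasurableSpace α where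
  MeasurableSet' := UniversallyMeasurableSet
  measurableSet_empty := fun _ _ => .empty
  measurableSet_compl := fun _ hs μ hμ => (hs μ hμ).compl
  measurableSet_iUnion := fun _ hf μ hμ => .iUnion fun i => hf i μ hμ

lemma UniversallyMeasurable.measurable {α β : Type*} [MeasurableSpace α] [MeasurableSpace β]
    {f : α → β} (hf : UniversallyMeasurable f) : Measurable[universalSpace α] f :=
  fun s hs => hf s hs

lemma UniversallyMeasurable.comp_measurable {α β γ : Type*} [MeasurableSpace α]
    [MeasurableSpace β] [MeasurableSpace γ] {g : β → γ} (hg : UniversallyMeasurable g)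
    {f : α → β} (hf : Measurable f) : UniversallyMeasurable fun a => g (f a) :=
  fun s hs => (hg s hs).preimage hf

lemma UniversallyMeasurable.measurable_comp {α β γ : Type*} [MeasurableSpace α]
    [MeasurableSpace β] [MeasurableSpace γ] {f : α → β} (hf : UniversallyMeasurable f)
    {g : β → γ} (hg : Measurable g) : UniversallyMeasurable fun a => g (f a) :=
  fun _ hs => hf _ (hg hs)

lemma UniversallyMeasurable.aemeasurable {α β : Type*} [MeasurableSpace α] [MeasurableSpace β]
    [MeasurableSpace.CountablyGenerated β] {f : α → β} (hf : UniversallyMeasurable f)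
    (μ : Measure α) [IsProbabilityMeasure μ] : AEMeasurable f μ :=
  NullMeasurable.aemeasurable fun s hs => hf s hs μ inferInstance

/-- The intersection of a set `S` of sequences with the constraint that its `n`-th coordinate be
bounded can be chosen to have an image of almost full outer measure. -/
lemma exists_lt_measure_image_inter {α : Type*} [MeasurableSpace α] {μ : Measure α}
    (g : (ℕ → ℕ) → α) {c : ℝ≥0∞} (n : ℕ) (S : Set (ℕ → ℕ)) (hS : c < μ (g '' S)) :
    ∃ k, c < μ (g '' (S ∩ {z | z n ≤ k})) := by
  have h1 : g '' S = ⋃ k, g '' (S ∩ {z | z n ≤ k}) := by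
    rw [← Set.image_iUnion, ← Set.inter_iUnion]
    congr 1
    ext z
    simp only [Set.mem_inter_iff, Set.mem_iUnion, Set.mem_ofPred_eq]
    exact ⟨fun h => ⟨h, z n, le_rfl⟩, fun h => h.1⟩
  have h2 : Monotone fun k => g '' (S ∩ {z : ℕ → ℕ | z n ≤ k}) := fun i j hij =>
    Set.image_mono (Set.inter_subset_inter_right _ fun z (hz : z n ≤ i) => hz.trans hij)
  rw [h1, h2.measure_iUnion] at hS
  exact lt_iSup_iff.1 hS

lemma exists_isCompact_image_of_lt_measure_range {α : Type*} [TopologicalSpace α] [PolishSpace α]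
    [MeasurableSpace α] [BorelSpace α] (μ : Measure α) [IsFiniteMeasure μ] {g : (ℕ → ℕ) → α}
    (hg : Continuous g) {c : ℝ≥0∞} (hc : c < μ (Set.range g)) :
    ∃ K : Set (ℕ → ℕ), IsCompact K ∧ c ≤ μ (g '' K) := by
  choose! m hm using fun n S => exists_lt_measure_image_inter (μ := μ) g (c := c) n S
  let S : ℕ → Set (ℕ → ℕ) := fun n =>
    Nat.rec Set.univ (fun n S => S ∩ {z | z n ≤ m n S}) n
  have hS : ∀ n, c < μ (g '' (S n)) := by
    intro n
    induction n with
    | zero => simpa [S] using hc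
    | succ n ih => exact hm n (S n) ih
  let k : ℕ → ℕ := fun n => m n (S n)
  have hSk : ∀ n z, z ∈ S n ↔ ∀ i < n, z i ≤ k i := by
    intro n
    induction n with
    | zero => simp [S]
    | succ n ih =>
      intro z
      rw [show S (n + 1) = S n ∩ {z | z n ≤ k n} from rfl, Set.mem_inter_iff, ih]
      simp only [Set.mem_ofPred_eq, Nat.forall_lt_succ_right]
  have hK : IsCompact (Set.univ.pi fun i => Set.Iic (k i)) :=
    isCompact_univ_pi fun i => (Set.finite_Iic (k i)).isCompact
  refine ⟨_, hK, ?_⟩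
  rw [Set.measure_eq_iInf_isOpen]
  refine le_iInf fun V => le_iInf fun hKV => le_iInf fun hV => ?_
  by_contra! hlt
  have hne : ∀ n, ∃ z ∈ S n, g z ∉ V := by
    intro n
    by_contra! h
    exact absurd (measure_mono (Set.image_subset_iff.2 h)) (not_le.2 (hlt.trans (hS n)))
  choose z hzS hzV using hne
  obtain ⟨w, hwK, φ, hφ, hw⟩ := hK.tendsto_subseq (x := fun n i => min (z n i) (k i))
    fun n i _ => Set.mem_Iic.2 (min_le_right _ _)
  have hz : Tendsto (z ∘ φ) atTop (𝓝 w) := by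
    rw [tendsto_pi_nhds] at hw ⊢
    intro i
    refine (hw i).congr' ?_
    filter_upwards [hφ.tendsto_atTop.eventually_gt_atTop i] with n hn
    exact min_eq_left ((hSk _ _).1 (hzS (φ n)) i hn)
  have hev : ∀ᶠ n in atTop, (z ∘ φ) n ∈ g ⁻¹' V :=
    hz.eventually ((hV.preimage hg).mem_nhds (hKV ⟨w, hwK, rfl⟩))
  obtain ⟨n, hn⟩ := hev.exists
  exact hzV _ hn

/-- Analytic sets are universally measurable. -/
lemma AnalyticSet.universallyMeasurableSet {α : Type*} [TopologicalSpace α] [PolishSpace α]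
    [MeasurableSpace α] [BorelSpace α] {s : Set α} (hs : MeasureTheory.AnalyticSet s) :
    UniversallyMeasurableSet s := by
  intro μ hμ
  rw [MeasureTheory.AnalyticSet] at hs
  obtain rfl | ⟨g, hg, rfl⟩ := hs
  · exact .empty
  rcases eq_or_ne (μ (Set.range g)) 0 with h0 | h0
  · exact NullMeasurableSet.of_null h0
  obtain ⟨u, -, hu, hlim⟩ := exists_seq_strictMono_tendsto' (pos_iff_ne_zero.2 h0)
  choose K hK hKu using fun n =>
    exists_isCompact_image_of_lt_measure_range μ hg (hu n).2
  have hmeas : MeasurableSet (⋃ n, g '' K n) :=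
    .iUnion fun n => ((hK n).image hg).isClosed.measurableSet
  have hsub : (⋃ n, g '' K n) ⊆ Set.range g :=
    Set.iUnion_subset fun n => Set.image_subset_range _ _
  have hle : μ (Set.range g) ≤ μ (⋃ n, g '' K n) :=
    le_of_tendsto' hlim fun n => (hKu n).trans (measure_mono (Set.subset_iUnion (fun n => g '' K n) n))
  exact hmeas.nullMeasurableSet.congr
    (ae_eq_of_subset_of_measure_ge hsub hle hmeas.nullMeasurableSet (measure_ne_top _ _))

/-- The leftmost branch through a tree of sets `R`, as a function of the point to be followed:
given the first values, the next one is the least `k` for which the point still lies in `R`. -/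
def leftmostSegment {α : Type*} (R : List ℕ → Set α) : ℕ → α → List ℕ
  | 0, _ => []
  | n + 1, y => leftmostSegment R n y ++ [sInf {k | y ∈ R (leftmostSegment R n y ++ [k])}]

/-- The infinite sequence whose initial segments are given by `leftmostSegment`. -/
def leftmostBranch {α : Type*} (R : List ℕ → Set α) (y : α) (n : ℕ) : ℕ :=
  sInf {k | y ∈ R (leftmostSegment R n y ++ [k])}

lemma leftmostSegment_succ {α : Type*} (R : List ℕ → Set α) (n : ℕ) (y : α) :
    leftmostSegment R (n + 1) y = leftmostSegment R n y ++ [leftmostBranch R y n] := rfl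

lemma leftmostSegment_eq_map {α : Type*} (R : List ℕ → Set α) (n : ℕ) (y : α) :
    leftmostSegment R n y = (List.range n).map (leftmostBranch R y) := by
  induction n with
  | zero => rfl
  | succ n ih => rw [leftmostSegment_succ, List.range_succ, List.map_append, ← ih]; rfl

lemma measurable_sInf_nat {α : Type*} [MeasurableSpace α] {R : ℕ → Set α}
    (hR : ∀ k, MeasurableSet (R k)) : Measurable fun y => sInf {k | y ∈ R k} := by
  refine measurable_to_countable' fun j => ?_
  have : (fun y => sInf {k | y ∈ R k}) ⁻¹' {j} =
      (R j ∩ ⋂ i : ℕ, ⋂ _ : i < j, (R i)ᶜ) ∪ ({_y | j = 0} ∩ ⋂ i : ℕ, (R i)ᶜ) := by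
    ext y
    simp only [Set.mem_preimage, Set.mem_singleton_iff, Set.mem_union, Set.mem_inter_iff,
      Set.mem_iInter, Set.mem_compl_iff, Set.mem_ofPred_eq]
    by_cases hne : {k | y ∈ R k}.Nonempty
    · have h1 := Nat.sInf_mem hne
      constructor
      · rintro rfl
        exact Or.inl ⟨h1, fun i hi => Nat.notMem_of_lt_sInf hi⟩
      · rintro (⟨h2, h3⟩ | ⟨-, h2⟩)
        · refine le_antisymm (Nat.sInf_le h2) ?_
          by_contra! h4
          exact h3 _ h4 h1
        · exact absurd h1 (h2 _)
    · have hn : ∀ i, y ∉ R i := fun i hi => hne ⟨i, hi⟩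
      simp [hn, eq_comm]
  rw [this]
  exact ((hR j).inter (.iInter fun i => .iInter fun _ => (hR i).compl)).union
    ((MeasurableSet.const _).inter (.iInter fun i => (hR i).compl))

lemma measurable_leftmostBranch {α : Type*} [MeasurableSpace α] {R : List ℕ → Set α}
    (hR : ∀ l, MeasurableSet (R l)) : Measurable (leftmostBranch R) := by
  have step : ∀ n, (∀ l, MeasurableSet {y | leftmostSegment R n y = l}) →
      Measurable fun y => leftmostBranch R y n := by
    intro n h
    refine measurable_to_countable' fun j => ?_
    have : (fun y => leftmostBranch R y n) ⁻¹' {j} =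
        ⋃ l, {y | leftmostSegment R n y = l} ∩
          ((fun y => sInf {k | y ∈ R (l ++ [k])}) ⁻¹' {j}) := by
      ext y
      simp [leftmostBranch]
    rw [this]
    exact .iUnion fun l => (h l).inter
      (measurable_sInf_nat (fun k => hR (l ++ [k])) (measurableSet_singleton j))
  have hpre : ∀ n l, MeasurableSet {y | leftmostSegment R n y = l} := by
    intro n
    induction n with
    | zero => exact fun l => MeasurableSet.const ([] = l)
    | succ n ih =>
      intro l
      have : {y | leftmostSegment R (n + 1) y = l} = ⋃ l' : List ℕ, ⋃ j : ℕ,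
          ({y | leftmostSegment R n y = l'} ∩ ((fun y => leftmostBranch R y n) ⁻¹' {j})) ∩
            {_y | l' ++ [j] = l} := by
        ext y
        simp [leftmostSegment_succ]
      rw [this]
      exact .iUnion fun l' => .iUnion fun j =>
        ((ih l').inter (step n ih (measurableSet_singleton j))).inter (MeasurableSet.const _)
  exact measurable_pi_lambda _ fun n => step n (hpre n)

/-- **Jankov–von Neumann uniformization**: a continuous map from the Baire space has a
universally measurable right inverse on its range. -/
lemma exists_universallyMeasurable_rightInverse {α : Type*} [TopologicalSpace α] [PolishSpace α]
    [MeasurableSpace α] [BorelSpace α] {g : (ℕ → ℕ) → α} (hg : Continuous g) :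
    ∃ t : α → ℕ → ℕ, UniversallyMeasurable t ∧ ∀ y ∈ Set.range g, g (t y) = y := by
  let cyl : List ℕ → Set (ℕ → ℕ) := fun l => {z | (List.range l.length).map z = l}
  have hcyl_open : ∀ l, IsOpen (cyl l) := by
    intro l
    have : Continuous fun z : ℕ → ℕ => (fun i : Fin l.length => z i) := by fun_prop
    have h2 : cyl l = (fun z : ℕ → ℕ => (fun i : Fin l.length => z i)) ⁻¹' {l.get} := by
      ext z
      simp only [cyl, Set.mem_ofPred_eq, Set.mem_preimage, Set.mem_singleton_iff]
      constructor
      · intro h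
        funext i
        have := List.getElem_of_eq h (i := i) (by simp)
        simpa using this
      · intro h
        refine List.ext_getElem (by simp) fun i h1 h2 => ?_
        simpa using congrFun h ⟨i, h2⟩
    rw [h2]
    exact (isOpen_discrete _).preimage this
  let R : List ℕ → Set α := fun l => g '' cyl l
  have hR : ∀ l, MeasurableSet[universalSpace α] (R l) := fun l =>
    AnalyticSet.universallyMeasurableSet ((hcyl_open l).analyticSet_image hg)
  refine ⟨leftmostBranch R, fun s hs => @measurable_leftmostBranch α (universalSpace α) R hR s hs,
    fun y hy => ?_⟩
  have hmem : ∀ n, y ∈ R (leftmostSegment R n y) := by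
    intro n
    induction n with
    | zero =>
      obtain ⟨z, rfl⟩ := hy
      exact ⟨z, by simp [cyl, leftmostSegment], rfl⟩
    | succ n ih =>
      obtain ⟨z, hz, hzy⟩ := ih
      have hlen : (leftmostSegment R n y).length = n := by simp [leftmostSegment_eq_map]
      have hne : {k | y ∈ R (leftmostSegment R n y ++ [k])}.Nonempty := by
        refine ⟨z n, z, ?_, hzy⟩
        simp only [cyl, Set.mem_ofPred_eq, hlen] at hz
        simp [cyl, hlen, List.range_succ, hz]
      exact Nat.sInf_mem hne
  choose z hz hzy using hmem
  have hzt : ∀ n, ∀ i < n, z n i = leftmostBranch R y i := by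
    intro n i hi
    have h := hz n
    simp only [cyl, Set.mem_ofPred_eq, leftmostSegment_eq_map, List.length_map,
      List.length_range] at h
    exact List.map_inj_left.1 h i (List.mem_range.2 hi)
  have hlim : Tendsto z atTop (𝓝 (leftmostBranch R y)) := by
    rw [tendsto_pi_nhds]
    intro i
    refine tendsto_const_nhds.congr' ?_
    filter_upwards [eventually_gt_atTop i] with n hn
    exact (hzt n i hn).symm
  refine tendsto_nhds_unique ((hg.tendsto _).comp hlim) ?_
  simp [Function.comp_def, hzy]

/-- A set-valued map with nonempty values and analytic graph has a universally measurable
selector. -/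
lemma exists_universallyMeasurable_selector {X A : Type*} [TopologicalSpace X] [PolishSpace X]
    [MeasurableSpace X] [BorelSpace X] [TopologicalSpace A] [MeasurableSpace A] [BorelSpace A]
    {Acts : X → Set A} (hne : ∀ x, (Acts x).Nonempty)
    (hΓ : MeasureTheory.AnalyticSet {xa : X × A | xa.2 ∈ Acts xa.1}) :
    ∃ s : X → A, UniversallyMeasurable s ∧ ∀ x, s x ∈ Acts x := by
  rw [MeasureTheory.AnalyticSet] at hΓ
  obtain h | ⟨g, hg, hgr⟩ := hΓ
  · have hX : IsEmpty X := ⟨fun x => by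
      obtain ⟨a, ha⟩ := hne x
      exact Set.eq_empty_iff_forall_notMem.1 h (x, a) ha⟩
    exact ⟨isEmptyElim, fun s _ μ _ => by simp [Set.eq_empty_of_isEmpty], isEmptyElim⟩
  obtain ⟨t, ht, htg⟩ := exists_universallyMeasurable_rightInverse (continuous_fst.comp hg)
  refine ⟨fun x => (g (t x)).2, ht.measurable_comp (continuous_snd.comp hg).measurable,
    fun x => ?_⟩
  obtain ⟨a, ha⟩ := hne x
  obtain ⟨z, hz⟩ : (x, a) ∈ Set.range g := hgr ▸ ha
  have hx : (g (t x)).1 = x := htg x ⟨z, by simp [hz]⟩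
  have hmem : g (t x) ∈ {xa : X × A | xa.2 ∈ Acts xa.1} := hgr ▸ Set.mem_range_self _
  rw [← hx]
  simpa [hx] using hmem

/-! ### The space of probability measures over a Polish space -/

lemma measurable_probabilityMeasure_toMeasure {Ω : Type*} [TopologicalSpace Ω] [PolishSpace Ω]
    [MeasurableSpace Ω] [BorelSpace Ω] :
    @Measurable _ _ instMeasProb _ fun p : ProbabilityMeasure Ω => p.toMeasure := by
  have : BorelSpace (ProbabilityMeasure Ω) := ⟨rfl⟩
  refine Measurable.measure_of_isPiSystem_of_isProbabilityMeasure
    BorelSpace.measurable_eq isPiSystem_isOpen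
    fun U hU => ?_
  refine LowerSemicontinuous.measurable (lowerSemicontinuous_iff_le_liminf.2 fun p => ?_)
  exact ProbabilityMeasure.le_liminf_measure_open_of_tendsto tendsto_id hU

lemma isInducing_map_probabilityMeasure {Ω K : Type*} [TopologicalSpace Ω]
    [MeasurableSpace Ω] [BorelSpace Ω] [TopologicalSpace K] [PolishSpace K] [MeasurableSpace K]
    [BorelSpace K] {e : Ω → K} (he : Topology.IsEmbedding e) :
    Topology.IsInducing fun p : ProbabilityMeasure Ω =>
      p.map he.continuous.measurable.aemeasurable := by
  refine Topology.isInducing_iff_nhds.2 fun p => le_antisymm ?_ ?_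
  · exact (ProbabilityMeasure.continuous_map he.continuous).continuousAt.tendsto.le_comap
  · set J : ProbabilityMeasure Ω → ProbabilityMeasure K := fun p =>
      p.map he.continuous.measurable.aemeasurable
    refine tendsto_of_forall_isOpen_le_liminf' (L := comap J (𝓝 (J p))) (μs := fun p => p)
      fun U hU => ?_
    obtain ⟨V, hV, rfl⟩ := he.isInducing.isOpen_iff.1 hU
    have key := ProbabilityMeasure.le_liminf_measure_open_of_tendsto
      (tendsto_comap (f := J) (x := 𝓝 (J p))) hV
    have hmap : ∀ p : ProbabilityMeasure Ω, (J p).toMeasure V = p.toMeasure (e ⁻¹' V) :=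
      fun p => Measure.map_apply he.continuous.measurable hV.measurableSet
    simpa only [hmap] using key

/-- The space of probability measures over a Polish space is a continuous image of a Polish
space. -/
lemma exists_polishSpace_continuous_surjective (Ω : Type*) [TopologicalSpace Ω] [PolishSpace Ω]
    [MeasurableSpace Ω] [BorelSpace Ω] :
    ∃ (Z : Type) (_ : TopologicalSpace Z) (_ : PolishSpace Z) (φ : Z → ProbabilityMeasure Ω),
      Continuous φ ∧ Function.Surjective φ := by
  obtain ⟨e, he⟩ : ∃ e : Ω → ℕ → unitInterval, Topology.IsEmbedding e := by
    let _ := TopologicalSpace.metrizableSpaceMetric Ω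
    exact Metric.PiNatEmbed.exists_embedding_to_hilbert_cube
  let K := ℕ → unitInterval
  have hPK : PolishSpace (ProbabilityMeasure K) := by
    let _ := TopologicalSpace.metrizableSpaceMetric (ProbabilityMeasure K)
    infer_instance
  let J : ProbabilityMeasure Ω → ProbabilityMeasure K := fun p =>
    p.map he.continuous.measurable.aemeasurable
  have hJ : Topology.IsInducing J := isInducing_map_probabilityMeasure he
  have hG : MeasurableSet (Set.range e) :=
    measurableSet_range_of_continuous_injective he.continuous he.injective
  have hemb : MeasurableEmbedding e := he.continuous.measurableEmbedding he.injective
  have hrange : Set.range J = {μ | μ.toMeasure (Set.range e) = 1} := by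
    ext μ
    constructor
    · rintro ⟨p, rfl⟩
      show (p.toMeasure.map e) _ = 1
      rw [Measure.map_apply hemb.measurable hG]
      simp
    · intro hμ
      have hmap : (μ.toMeasure.comap e).map e = μ.toMeasure := by
        rw [hemb.map_comap]
        exact Measure.restrict_eq_self_of_ae_mem ((prob_compl_eq_zero_iff hG).2 hμ)
      have : IsProbabilityMeasure (μ.toMeasure.comap e) := by
        constructor
        rw [hemb.comap_apply, Set.image_univ]
        exact hμ
      exact ⟨⟨_, this⟩, Subtype.ext hmap⟩
  have hR : MeasureTheory.AnalyticSet (Set.range J) := by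
    have : BorelSpace (ProbabilityMeasure K) := ⟨rfl⟩
    refine MeasurableSet.analyticSet ?_
    rw [hrange]
    exact ((Measure.measurable_coe hG).comp measurable_probabilityMeasure_toMeasure)
      (measurableSet_singleton 1)
  rw [analyticSet_iff_exists_polishSpace_range] at hR
  obtain ⟨Z, _, _, f, hf, hfr⟩ := hR
  choose φ hφ using fun z => (hfr ▸ Set.mem_range_self z : f z ∈ Set.range J)
  have hJinj : Function.Injective J := fun p p' hpp => Subtype.ext <| by
    have h1 : p.toMeasure.map e = p'.toMeasure.map e := congrArg ProbabilityMeasure.toMeasure hpp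
    exact ((hemb.comap_map p.toMeasure).symm.trans (congrArg _ h1)).trans
      (hemb.comap_map p'.toMeasure)
  refine ⟨Z, inferInstance, inferInstance, φ, ?_, fun p => ?_⟩
  · rw [hJ.continuous_iff]
    exact hf.congr fun z => (hφ z).symm
  · obtain ⟨z, hz⟩ := hfr.symm ▸ Set.mem_range_self (f := J) p
    exact ⟨z, hJinj ((hφ z).trans hz)⟩

lemma measurable_measureOn {Ω : Type*} [TopologicalSpace Ω] [PolishSpace Ω]
    [MeasurableSpace Ω] [BorelSpace Ω] {B : Set Ω} (hB : MeasurableSet B) :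
    @Measurable _ _ instMeasProb _ fun p : ProbabilityMeasure Ω => p.toMeasure B :=
  (Measure.measurable_coe hB).comp measurable_probabilityMeasure_toMeasure

lemma analyticSet_of_measurableSet_prod_probabilityMeasure {X Ω : Type*}
    [TopologicalSpace X] [PolishSpace X] [MeasurableSpace X] [BorelSpace X]
    [TopologicalSpace Ω] [PolishSpace Ω] [MeasurableSpace Ω] [BorelSpace Ω]
    {S : Set (X × ProbabilityMeasure Ω)} (hS : MeasurableSet S) :
    MeasureTheory.AnalyticSet S := by
  obtain ⟨Z, _, _, φ, hφ, hsurj⟩ := exists_polishSpace_continuous_surjective Ω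
  borelize Z
  have : BorelSpace (ProbabilityMeasure Ω) := ⟨rfl⟩
  have hmeas : Measurable (Prod.map id φ : X × Z → X × ProbabilityMeasure Ω) :=
    measurable_id.prodMap hφ.measurable
  have hcont : Continuous (Prod.map id φ : X × Z → X × ProbabilityMeasure Ω) :=
    continuous_id.prodMap hφ
  have hs : Function.Surjective (Prod.map id φ : X × Z → X × ProbabilityMeasure Ω) :=
    Function.surjective_id.prodMap hsurj
  rw [← Set.image_preimage_eq S hs]
  exact (hmeas hS).analyticSet.image_of_continuous hcont

lemma AnalyticSet.preimage_snd_probabilityMeasure {X Ω : Type*}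
    [TopologicalSpace X] [PolishSpace X]
    [TopologicalSpace Ω] [PolishSpace Ω] [MeasurableSpace Ω] [BorelSpace Ω]
    {S : Set (ProbabilityMeasure Ω)} (hS : MeasureTheory.AnalyticSet S) :
    MeasureTheory.AnalyticSet (Prod.snd ⁻¹' S : Set (X × ProbabilityMeasure Ω)) := by
  obtain ⟨Z, _, _, φ, hφ, hsurj⟩ := exists_polishSpace_continuous_surjective Ω
  have hcont : Continuous (Prod.map id φ : X × Z → X × ProbabilityMeasure Ω) :=
    continuous_id.prodMap hφ
  have hs : Function.Surjective (Prod.map id φ : X × Z → X × ProbabilityMeasure Ω) :=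
    Function.surjective_id.prodMap hsurj
  rw [← Set.image_preimage_eq (Prod.snd ⁻¹' S) hs]
  have h2 : MeasureTheory.AnalyticSet ((fun z : X × Z => φ z.2) ⁻¹' S) :=
    hS.preimage (hφ.comp continuous_snd)
  exact h2.image_of_continuous hcont

/-- The probability measures carried by a given analytic set form an analytic set. -/
lemma analyticSet_setOf_measure_eq_one {Ω : Type*} [TopologicalSpace Ω] [PolishSpace Ω]
    [MeasurableSpace Ω] [BorelSpace Ω] {G : Set Ω} (hG : MeasureTheory.AnalyticSet G) :
    MeasureTheory.AnalyticSet {p : ProbabilityMeasure Ω | p.toMeasure G = 1} := by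
  have hnull := AnalyticSet.universallyMeasurableSet hG
  rw [MeasureTheory.AnalyticSet] at hG
  rcases hG with rfl | ⟨g, hg, rfl⟩
  · simpa using MeasureTheory.analyticSet_empty
  obtain ⟨Z, _, _, φ, hφ, hsurj⟩ := exists_polishSpace_continuous_surjective (ℕ → ℕ)
  have hpush : Continuous fun z : Z => (φ z).map hg.measurable.aemeasurable :=
    (ProbabilityMeasure.continuous_map hg).comp hφ
  convert analyticSet_range_of_polishSpace hpush
  ext p
  constructor
  · intro hp
    obtain ⟨t, ht, hgt⟩ := exists_universallyMeasurable_rightInverse hg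
    have hta : AEMeasurable t p.toMeasure := ht.aemeasurable _
    obtain ⟨z, hz⟩ := hsurj (p.map hta)
    refine ⟨z, Subtype.ext ?_⟩
    have h1 : (φ z).toMeasure = p.toMeasure.map t := by rw [hz]; rfl
    show (φ z).toMeasure.map g = p.toMeasure
    have hae : ∀ᵐ y ∂p.toMeasure, y ∈ Set.range g :=
      (prob_compl_eq_zero_iff₀ (hnull _ inferInstance)).2 hp
    rw [h1, AEMeasurable.map_map_of_aemeasurable hg.measurable.aemeasurable hta]
    conv_rhs => rw [← Measure.map_id (μ := p.toMeasure)]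
    exact Measure.map_congr (hae.mono fun y hy => hgt y hy)
  · rintro ⟨z, rfl⟩
    show ((φ z).toMeasure.map g) _ = 1
    rw [Measure.map_apply₀ hg.measurable.aemeasurable
      (hnull _ (Measure.isProbabilityMeasure_map hg.measurable.aemeasurable))]
    simp

/-! ### Measurability of relations between kernels -/

lemma exists_countable_isPiSystem (E : Type*) [m : MeasurableSpace E]
    [MeasurableSpace.CountablyGenerated E] :
    ∃ C : Set (Set E), C.Countable ∧ IsPiSystem C ∧ m = MeasurableSpace.generateFrom C := by
  let G := MeasurableSpace.countableGeneratingSet E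
  have hG : G.Countable := MeasurableSpace.countable_countableGeneratingSet
  have hgen : MeasurableSpace.generateFrom G = m :=
    MeasurableSpace.generateFrom_countableGeneratingSet
  refine ⟨(fun s => ⋂₀ s) '' {s | s.Finite ∧ s ⊆ G},
    (Set.countable_ofPred_finite_subset hG).image _, ?_, le_antisymm ?_ ?_⟩
  · rintro _ ⟨s, ⟨hs, hsG⟩, rfl⟩ _ ⟨t, ⟨ht, htG⟩, rfl⟩ -
    exact ⟨s ∪ t, ⟨hs.union ht, Set.union_subset hsG htG⟩, Set.sInter_union s t⟩
  · rw [← hgen]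
    refine MeasurableSpace.generateFrom_mono fun u hu => ⟨{u}, ⟨Set.finite_singleton u, ?_⟩, ?_⟩
    · exact Set.singleton_subset_iff.2 hu
    · exact Set.sInter_singleton u
  · refine MeasurableSpace.generateFrom_le ?_
    rintro _ ⟨s, ⟨hs, hsG⟩, rfl⟩
    refine MeasurableSet.sInter hs.countable fun u hu => ?_
    exact hgen ▸ MeasurableSpace.measurableSet_generateFrom (hsG hu)

lemma measurableSet_setOf_measure_eq {T E : Type*} [MeasurableSpace T] [MeasurableSpace E]
    [MeasurableSpace.CountablyGenerated E] {κ η : T → Measure E} (hκ : Measurable κ)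
    (hη : Measurable η) [∀ t, IsProbabilityMeasure (κ t)] [∀ t, IsProbabilityMeasure (η t)] :
    MeasurableSet {t | κ t = η t} := by
  obtain ⟨C, hC, hpi, hgen⟩ := exists_countable_isPiSystem E
  have hCm : ∀ s ∈ C, MeasurableSet s := fun s hs =>
    hgen ▸ MeasurableSpace.measurableSet_generateFrom hs
  have : {t | κ t = η t} = ⋂ s ∈ C, {t | κ t s = η t s} := by
    ext t
    simp only [Set.mem_ofPred_eq, Set.mem_iInter]
    refine ⟨fun h s _ => by rw [h], fun h => ?_⟩
    exact ext_of_generate_finite C hgen hpi h (by simp)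
  rw [this]
  refine MeasurableSet.biInter hC fun s hs => ?_
  exact measurableSet_eq_fun ((Measure.measurable_coe (hCm s hs)).comp hκ)
    ((Measure.measurable_coe (hCm s hs)).comp hη)

/-- A measure is a point mass. -/
def IsDirac {E : Type*} [MeasurableSpace E] (μ : Measure E) : Prop := ∃ a, μ = Measure.dirac a

lemma isDirac_iff_of_generateFrom {E : Type*} [m : MeasurableSpace E] [StandardBorelSpace E]
    {C : Set (Set E)} (hgen : m = MeasurableSpace.generateFrom C) (μ : Measure E)
    [IsProbabilityMeasure μ] : IsDirac μ ↔ ∀ s ∈ C, μ s = 0 ∨ μ s = 1 := by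
  constructor
  · rintro ⟨a, rfl⟩ s hs
    have hs' : MeasurableSet s := hgen ▸ MeasurableSpace.measurableSet_generateFrom hs
    rw [Measure.dirac_apply' _ hs']
    by_cases h : a ∈ s <;> simp [h]
  · intro h
    have : IsZeroOneMeasure μ := by
      constructor
      intro s hs
      rw [hgen] at hs
      induction s, hs using MeasurableSpace.generateFrom_induction with
      | hC s hs _ => exact h s hs
      | empty => simp
      | compl s hs ih =>
        rw [← hgen] at hs
        rcases ih with h0 | h1
        · exact Or.inr ((prob_compl_eq_one_iff hs).2 h0)
        · exact Or.inl ((prob_compl_eq_zero_iff hs).2 h1)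
      | iUnion s hs ih =>
        by_cases hall : ∀ n, μ (s n) = 0
        · exact Or.inl (measure_iUnion_null hall)
        · push Not at hall
          obtain ⟨n, hn⟩ := hall
          refine Or.inr (le_antisymm prob_le_one ?_)
          rw [← (ih n).resolve_left hn]
          exact measure_mono (Set.subset_iUnion s n)
    exact IsZeroOneMeasure.exists_eq_dirac

lemma measurableSet_isDirac {T E : Type*} [MeasurableSpace T] [MeasurableSpace E]
    [StandardBorelSpace E] {κ : T → Measure E} (hκ : Measurable κ)
    [∀ t, IsProbabilityMeasure (κ t)] :
    MeasurableSet {t | IsDirac (κ t)} := by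
  obtain ⟨C, hC, hpi, hgen⟩ := exists_countable_isPiSystem E
  have hCm : ∀ s ∈ C, MeasurableSet s := fun s hs =>
    hgen ▸ MeasurableSpace.measurableSet_generateFrom hs
  have : {t | IsDirac (κ t)} = ⋂ s ∈ C, {t | κ t s = 0 ∨ κ t s = 1} := by
    ext t
    simp only [Set.mem_ofPred_eq, Set.mem_iInter]
    exact isDirac_iff_of_generateFrom hgen _
  rw [this]
  refine MeasurableSet.biInter hC fun s hs => ?_
  have hm : Measurable fun t => κ t s := (Measure.measurable_coe (hCm s hs)).comp hκ
  exact (hm (measurableSet_singleton 0)).union (hm (measurableSet_singleton 1))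

lemma exists_markovKernel_ae_eq {F A : Type*} [MeasurableSpace F] [MeasurableSpace A]
    [MeasurableSpace.CountablyGenerated A] [Nonempty A] {m : F → Measure A}
    [∀ f, IsProbabilityMeasure (m f)]
    (hm : ∀ B, MeasurableSet B → UniversallyMeasurable fun f => m f B)
    (l : Measure F) [IsProbabilityMeasure l] :
    ∃ κ : Kernel F A, IsMarkovKernel κ ∧ ∀ᵐ f ∂l, m f = κ f := by
  classical
  obtain ⟨C, hC, hpi, hgen⟩ := exists_countable_isPiSystem A
  have hCm : ∀ s ∈ C, MeasurableSet s := fun s hs =>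
    hgen ▸ MeasurableSpace.measurableSet_generateFrom hs
  have hae : ∀ s ∈ C, AEMeasurable (fun f => m f s) l := fun s hs => (hm s (hCm s hs)).aemeasurable l
  choose! g hgm hg using hae
  have hall : ∀ᵐ f ∂l, ∀ s ∈ C, m f s = g s f := (ae_ball_iff hC).2 hg
  obtain ⟨E, hE, hEm, hEae⟩ : ∃ E : Set F, (∀ f ∈ E, ∀ s ∈ C, m f s = g s f) ∧
      MeasurableSet E ∧ ∀ᵐ f ∂l, f ∈ E := by
    obtain ⟨N, hN, hNm, hN0⟩ := exists_measurable_superset_of_null (ae_iff.1 hall)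
    refine ⟨Nᶜ, fun f hf => by_contra fun h => hf (hN h), hNm.compl, ?_⟩
    simpa [ae_iff] using hN0
  let a0 : A := Classical.arbitrary A
  let k : F → Measure A := fun f => if f ∈ E then m f else Measure.dirac a0
  have hk : ∀ f, IsProbabilityMeasure (k f) := fun f => by
    simp only [k]; split_ifs <;> infer_instance
  have hkm : Measurable k := by
    refine Measurable.measure_of_isPiSystem_of_isProbabilityMeasure hgen hpi fun s hs => ?_
    have : (fun f => k f s) = fun f => if f ∈ E then g s f else Measure.dirac a0 s := by
      ext f
      by_cases hf : f ∈ E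
      · simp [k, hf, hE f hf s hs]
      · simp [k, hf]
    rw [this]
    exact Measurable.ite hEm (hgm s hs) measurable_const
  refine ⟨⟨k, hkm⟩, ⟨hk⟩, hEae.mono fun f hf => ?_⟩
  simp [k, hf]

/-! ### Finite-dimensional distributions -/

section Trajectories

variable {X A : Type*} [MeasurableSpace X] [MeasurableSpace A]

/-- The history up to time `n` of a trajectory. -/
def hist (n : ℕ) (ω : Traj X A) : Hist X A n := (fun i => ω i, (ω n).1)

/-- Extend a history by an action and the next state. -/
def extend {n : ℕ} (h : Hist X A n) (a : A) (y : X) : Hist X A (n + 1) :=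
  (Fin.snoc h.1 (h.2, a), y)

lemma measurable_hist (n : ℕ) : Measurable (hist n : Traj X A → Hist X A n) := by
  unfold hist
  fun_prop

lemma measurable_extend (n : ℕ) :
    Measurable fun z : (Hist X A n × A) × X => extend z.1.1 z.1.2 z.2 := by
  unfold extend
  refine Measurable.prodMk (measurable_pi_lambda _ fun i => ?_) measurable_snd
  induction i using Fin.lastCases with
  | last => simp only [Fin.snoc_last]; fun_prop
  | cast i => simp only [Fin.snoc_castSucc]; fun_prop

/-- The transition kernel from a history and an action to the next state. -/
def nextState (q : Kernel (X × A) X) (n : ℕ) : Kernel (Hist X A n × A) X :=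
  q.comap (fun z => (z.1.2, z.2)) (by fun_prop)

instance (q : Kernel (X × A) X) [IsMarkovKernel q] (n : ℕ) : IsMarkovKernel (nextState q n) := by
  unfold nextState; infer_instance

/-- The law of the history at time `n + 1`, given the law of the history at time `n` and the
decision rule at time `n`. -/
def stepLaw (q : Kernel (X × A) X) {n : ℕ} (P : Measure (Hist X A n)) (κ : Kernel (Hist X A n) A) :
    Measure (Hist X A (n + 1)) :=
  ((P ⊗ₘ κ) ⊗ₘ nextState q n).map fun z => extend z.1.1 z.1.2 z.2

variable {q : Kernel (X × A) X} [IsMarkovKernel q]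

lemma aemeasurable_and_lintegral_stepLaw {n : ℕ} {P : Measure (Hist X A n)}
    [IsProbabilityMeasure P] {κ : Kernel (Hist X A n) A} [IsMarkovKernel κ]
    {ν : Hist X A n → Measure A} (hν : ∀ᵐ h ∂P, ν h = κ h) {f : Hist X A (n + 1) → ℝ≥0∞}
    (hf : AEMeasurable f (stepLaw q P κ)) :
    AEMeasurable (fun h => ∫⁻ a, ∫⁻ y, f (extend h a y) ∂(q (h.2, a)) ∂(ν h)) P ∧
    ∫⁻ h, ∫⁻ a, ∫⁻ y, f (extend h a y) ∂(q (h.2, a)) ∂(ν h) ∂P = ∫⁻ h, f h ∂(stepLaw q P κ) := by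
  obtain ⟨g, hg, hfg⟩ := hf
  have hgm : Measurable fun z : (Hist X A n × A) × X => g (extend z.1.1 z.1.2 z.2) :=
    hg.comp (measurable_extend n)
  have hinner : Measurable fun w : Hist X A n × A =>
      ∫⁻ y, g (extend w.1 w.2 y) ∂(nextState q n w) := hgm.lintegral_kernel_prod_right'
  have houter : Measurable fun h : Hist X A n =>
      ∫⁻ a, ∫⁻ y, g (extend h a y) ∂(nextState q n (h, a)) ∂(κ h) :=
    hinner.lintegral_kernel_prod_right'
  have hae := ae_of_ae_map (measurable_extend n).aemeasurable hfg
  have hae3 := (Measure.ae_ae_of_ae_compProd (Measure.ae_ae_of_ae_compProd hae))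
  have hG : (fun h => ∫⁻ a, ∫⁻ y, f (extend h a y) ∂(q (h.2, a)) ∂(ν h)) =ᵐ[P]
      fun h => ∫⁻ a, ∫⁻ y, g (extend h a y) ∂(nextState q n (h, a)) ∂(κ h) := by
    filter_upwards [hae3, hν] with h h1 h2
    rw [h2]
    refine lintegral_congr_ae ?_
    filter_upwards [h1] with a ha
    exact lintegral_congr_ae ha
  refine ⟨⟨_, houter, hG⟩, ?_⟩
  rw [lintegral_congr_ae hG, lintegral_congr_ae hfg, stepLaw, lintegral_map hg (measurable_extend n),
    Measure.lintegral_compProd hgm, Measure.lintegral_compProd hinner]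

lemma histInt_eq_lintegral {p0 : Measure X} {ν : ∀ n : ℕ, Hist X A n → Measure A}
    {P : ∀ n, Measure (Hist X A n)} [∀ n, IsProbabilityMeasure (P n)]
    {κ : ∀ n, Kernel (Hist X A n) A} [∀ n, IsMarkovKernel (κ n)]
    (h0 : P 0 = p0.map fun x => (Fin.elim0, x)) (hν : ∀ n, ∀ᵐ h ∂(P n), ν n h = κ n h)
    (n : ℕ) (hstep : ∀ k < n, P (k + 1) = stepLaw q (P k) (κ k))
    (f : Hist X A n → ℝ≥0∞) (hf : AEMeasurable f (P n)) :
    histInt p0 q ν n f = ∫⁻ h, f h ∂(P n) := by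
  induction n with
  | zero =>
    rw [h0] at hf ⊢
    rw [lintegral_map' hf (by fun_prop)]
    rfl
  | succ n ih =>
    have hs := hstep n n.lt_succ_self
    rw [hs] at hf ⊢
    obtain ⟨h1, h2⟩ := aemeasurable_and_lintegral_stepLaw (hν n) hf
    rw [← h2]
    exact ih (fun k hk => hstep k (hk.trans n.lt_succ_self)) _ h1

variable {Acts : X → Set A} {π : Policy Acts} {p0 : Measure X} {p : Measure (Traj X A)}
  [IsProbabilityMeasure p]

instance isProbabilityMeasure_map_hist (n : ℕ) : IsProbabilityMeasure (p.map (hist n)) :=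
  Measure.isProbabilityMeasure_map (measurable_hist n).aemeasurable

lemma induces_of_stepLaw {κ : ∀ n, Kernel (Hist X A n) A} [∀ n, IsMarkovKernel (κ n)]
    (hν : ∀ n, ∀ᵐ h ∂(p.map (hist n)), π.μ n h = κ n h)
    (hstep : ∀ n, p.map (hist (n + 1)) = stepLaw q (p.map (hist n)) (κ n)) :
    Induces q π (p.map fun ω => (ω 0).1) p := by
  intro n B hB
  have h0 : p.map (hist 0) =
      (p.map fun ω => (ω 0).1).map fun x => ((Fin.elim0, x) : Hist X A 0) := by
    rw [Measure.map_map (by fun_prop) (by fun_prop)]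
    congr 1
    ext ω
    · rename_i i; exact i.elim0
    · rename_i i; exact i.elim0
    · rfl
  rw [histInt_eq_lintegral (P := fun n => p.map (hist n)) (κ := κ) h0 hν n (fun k _ => hstep k) _
    (measurable_const.indicator hB).aemeasurable, lintegral_indicator_const hB, one_mul,
    Measure.map_apply (measurable_hist n) hB]
  rfl

lemma Induces.map_hist_succ (hp : Induces q π p0 p)
    {κ : ∀ n, Kernel (Hist X A n) A} [∀ n, IsMarkovKernel (κ n)]
    (hν : ∀ n, ∀ᵐ h ∂(p.map (hist n)), π.μ n h = κ n h) (n : ℕ) :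
    p.map (hist (n + 1)) = stepLaw q (p.map (hist n)) (κ n) := by
  have h0 : p.map (hist 0) = p0.map fun x => ((Fin.elim0, x) : Hist X A 0) := by
    ext B hB
    rw [Measure.map_apply (measurable_hist 0) hB]
    refine (hp 0 B hB).trans ?_
    rw [← lintegral_indicator_one hB, lintegral_map (measurable_one.indicator hB) (by fun_prop)]
    rfl
  induction n using Nat.strong_induction_on with
  | _ n ih =>
    ext B hB
    rw [Measure.map_apply (measurable_hist _) hB]
    refine (hp (n + 1) B hB).trans ?_
    have hm : AEMeasurable (B.indicator fun _ => (1 : ℝ≥0∞))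
      (stepLaw q (p.map (hist n)) (κ n)) := (measurable_const.indicator hB).aemeasurable
    obtain ⟨h1, h2⟩ := aemeasurable_and_lintegral_stepLaw (hν n) hm
    rw [← lintegral_indicator_one hB]
    refine Eq.trans ?_ h2
    exact histInt_eq_lintegral (P := fun n => p.map (hist n)) h0 hν n ih _ h1

end Trajectories

lemma UniversallyMeasurable.ite {α β : Type*} [MeasurableSpace α] [MeasurableSpace β]
    {f g : α → β} (hf : UniversallyMeasurable f) (hg : UniversallyMeasurable g) {D : Set α}
    [DecidablePred (· ∈ D)] (hD : MeasurableSet D) :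
    UniversallyMeasurable fun a => if a ∈ D then f a else g a :=
  fun _ hs => Measurable.ite (m := universalSpace α) (UniversallyMeasurableSet.of_measurableSet hD)
    hf.measurable hg.measurable hs

section Features

variable {X A F : Type*} [MeasurableSpace X] [MeasurableSpace A] [MeasurableSpace F]

/-- The law of the features of the history together with the action taken at a random time. -/
def mixLaw (φ : ∀ n, Hist X A n → F) (p : Measure (Traj X A)) : Measure (F × A) :=
  ((Measure.count : Measure ℕ).toFinite.prod p).map
    fun z => (φ z.1 (hist z.1 z.2), (z.2 z.1).2)

lemma measurable_mixLaw_map {φ : ∀ n, Hist X A n → F} (hφ : ∀ n, Measurable (φ n)) :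
    Measurable fun z : ℕ × Traj X A => (φ z.1 (hist z.1 z.2), (z.2 z.1).2) :=
  measurable_from_prod_countable_right fun n =>
    ((hφ n).comp (measurable_hist n)).prodMk (measurable_pi_apply n).snd

instance : IsProbabilityMeasure (Measure.count : Measure ℕ).toFinite := inferInstance

variable {p : Measure (Traj X A)} {q : Kernel (X × A) X} [IsMarkovKernel q]

lemma map_hist_action {n : ℕ} {κ : Kernel (Hist X A n) A} [IsMarkovKernel κ]
    (h : p.map (hist (n + 1)) = stepLaw q (p.map (hist n)) κ) :
    p.map (fun ω => (hist n ω, (ω n).2)) = p.map (hist n) ⊗ₘ κ := by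
  let r : Hist X A (n + 1) → Hist X A n × A := fun h =>
    ((fun i => h.1 i.castSucc, (h.1 (Fin.last n)).1), (h.1 (Fin.last n)).2)
  have hr : Measurable r := by fun_prop
  have h1 : p.map (fun ω => (hist n ω, (ω n).2)) = (p.map (hist (n + 1))).map r := by
    rw [Measure.map_map hr (measurable_hist _)]
    rfl
  have h2 : (r ∘ fun z : (Hist X A n × A) × X => extend z.1.1 z.1.2 z.2) = Prod.fst := by
    ext z <;> simp [r, extend]
  rw [h1, h, stepLaw, Measure.map_map hr (measurable_extend n), h2]
  exact Measure.fst_compProd _ _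

variable {φ : ∀ n, Hist X A n → F} [IsProbabilityMeasure p]

lemma isProbabilityMeasure_mixLaw (hφ : ∀ n, Measurable (φ n)) :
    IsProbabilityMeasure (mixLaw φ p) :=
  Measure.isProbabilityMeasure_map (measurable_mixLaw_map hφ).aemeasurable

lemma ae_toFinite_count {P : ℕ → Prop} (h : ∀ᵐ n ∂(Measure.count : Measure ℕ).toFinite, P n) :
    ∀ n, P n := by
  rwa [Measure.ae_count_iff.symm, ← ae_toFinite]

lemma ae_hist_of_ae_mixLaw (hφ : ∀ n, Measurable (φ n)) {Q : F × A → Prop}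
    (h : ∀ᵐ z ∂(mixLaw φ p), Q z) (n : ℕ) : ∀ᵐ ω ∂p, Q (φ n (hist n ω), (ω n).2) :=
  ae_toFinite_count
    (Measure.ae_ae_of_ae_prod (ae_of_ae_map (measurable_mixLaw_map hφ).aemeasurable h)) n

lemma ae_mixLaw (hφ : ∀ n, Measurable (φ n)) {Q : F × A → Prop} (hQ : MeasurableSet {z | Q z})
    (h : ∀ n, ∀ᵐ ω ∂p, Q (φ n (hist n ω), (ω n).2)) : ∀ᵐ z ∂(mixLaw φ p), Q z := by
  rw [mixLaw, ae_map_iff (measurable_mixLaw_map hφ).aemeasurable hQ,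
    Measure.ae_prod_iff_ae_ae (p := fun z => Q (φ z.1 (hist z.1 z.2), (z.2 z.1).2))
      (measurable_mixLaw_map hφ hQ)]
  exact Eventually.of_forall h

lemma ae_hist_of_ae_fst_mixLaw (hφ : ∀ n, Measurable (φ n)) {Q : F → Prop}
    (h : ∀ᵐ f ∂(mixLaw φ p).fst, Q f) (n : ℕ) : ∀ᵐ ω ∂p, Q (φ n (hist n ω)) :=
  ae_hist_of_ae_mixLaw hφ (Q := fun z => Q z.1) (ae_of_ae_map measurable_fst.aemeasurable h) n

lemma ae_map_hist_of_ae_fst_mixLaw (hφ : ∀ n, Measurable (φ n)) {Q : F → Prop}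
    (h : ∀ᵐ f ∂(mixLaw φ p).fst, Q f) (n : ℕ) : ∀ᵐ h ∂(p.map (hist n)), Q (φ n h) := by
  obtain ⟨t, ht, htm, ht0⟩ := exists_measurable_superset_of_null (ae_iff.1 h)
  have h1 : ∀ᵐ f ∂(mixLaw φ p).fst, f ∈ tᶜ := by simpa [ae_iff] using ht0
  have h2 : ∀ᵐ h ∂(p.map (hist n)), φ n h ∈ tᶜ :=
    (ae_map_iff (measurable_hist n).aemeasurable (hφ n htm.compl)).2
      (ae_hist_of_ae_fst_mixLaw hφ h1 n)
  exact h2.mono fun h hh => by_contra fun hQ => hh (ht hQ)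

lemma ae_fst_mixLaw (hφ : ∀ n, Measurable (φ n)) {Q : F → Prop} (hQ : MeasurableSet {f | Q f})
    (h : ∀ n, ∀ᵐ ω ∂p, Q (φ n (hist n ω))) : ∀ᵐ f ∂(mixLaw φ p).fst, Q f := by
  rw [Measure.fst, ae_map_iff measurable_fst.aemeasurable hQ]
  exact ae_mixLaw hφ (measurable_fst hQ) h

lemma mixLaw_eq_compProd (hφ : ∀ n, Measurable (φ n)) {κ : Kernel F A} [IsMarkovKernel κ]
    (h : ∀ n, p.map (hist (n + 1)) = stepLaw q (p.map (hist n)) (κ.comap (φ n) (hφ n))) :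
    mixLaw φ p = (mixLaw φ p).fst ⊗ₘ κ := by
  have := isProbabilityMeasure_mixLaw (p := p) hφ
  ext S hS
  have hk : Measurable fun f => κ f (Prod.mk f ⁻¹' S) := Kernel.measurable_kernel_prodMk_left hS
  rw [Measure.compProd_apply hS, Measure.fst, lintegral_map hk measurable_fst, mixLaw,
    lintegral_map (f := fun z : F × A => κ z.1 (Prod.mk z.1 ⁻¹' S)) (hk.comp measurable_fst)
      (measurable_mixLaw_map hφ),
    Measure.map_apply (measurable_mixLaw_map hφ) hS,
    Measure.prod_apply (measurable_mixLaw_map hφ hS),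
    lintegral_prod (fun z : ℕ × Traj X A => κ (φ z.1 (hist z.1 z.2))
      (Prod.mk (φ z.1 (hist z.1 z.2)) ⁻¹' S)) ((hk.comp measurable_fst).comp (measurable_mixLaw_map hφ)).aemeasurable]
  refine lintegral_congr fun n => ?_
  have hm : Measurable fun z : Hist X A n × A => (φ n z.1, z.2) :=
    ((hφ n).comp measurable_fst).prodMk measurable_snd
  have hm' : Measurable fun ω : Traj X A => (hist n ω, (ω n).2) :=
    (measurable_hist n).prodMk (measurable_pi_apply n).snd
  have key := congrArg (fun μ => μ ((fun z : Hist X A n × A => (φ n z.1, z.2)) ⁻¹' S))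
    (map_hist_action (h n))
  simp only [Measure.map_apply hm' (hm hS), Measure.compProd_apply (hm hS)] at key
  refine Eq.trans key ?_
  rw [lintegral_map (Kernel.measurable_kernel_prodMk_left (hm hS)) (measurable_hist n)]
  rfl

end Features

/-! ### Characterization of strategic measures -/

section Characterization

variable {X A F : Type*} [TopologicalSpace X] [PolishSpace X] [MeasurableSpace X] [BorelSpace X]
  [TopologicalSpace A] [PolishSpace A] [MeasurableSpace A] [BorelSpace A] [MeasurableSpace F]

/-- The class `C` consists of the policies whose decision rules are functions of the features
`φ`. -/
def IsFeatureClass {Acts : X → Set A} (φ : ∀ n, Hist X A n → F) (C : Policy Acts → Prop) : Prop :=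
  ∀ π : Policy Acts, C π ↔ ∃ m : F → Measure A, (∀ f, IsProbabilityMeasure (m f)) ∧
    (∀ B, MeasurableSet B → UniversallyMeasurable fun f => m f B) ∧ ∀ n h, π.μ n h = m (φ n h)

/-- The conditions on a disintegration kernel of the law of features and actions which
characterize the strategic measures. -/
structure IsStrategic (q : Kernel (X × A) X) {φ : ∀ n, Hist X A n → F}
    (hφ : ∀ n, Measurable (φ n)) (nr : Prop) (p : Measure (Traj X A)) (K : Kernel F A) : Prop where
  step : ∀ n, p.map (hist (n + 1)) = stepLaw q (p.map (hist n)) (K.comap (φ n) (hφ n))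
  dirac : nr → ∀ᵐ f ∂(mixLaw φ p).fst, IsDirac (K f)

variable {q : Kernel (X × A) X} [IsMarkovKernel q] {Acts : X → Set A}
  {φ : ∀ n, Hist X A n → F} {hφ : ∀ n, Measurable (φ n)} {C : Policy Acts → Prop} {nr : Prop}
  {p : Measure (Traj X A)} [IsProbabilityMeasure p] {K : Kernel F A} [IsMarkovKernel K]

lemma IsFeatureClass.isStrategic_and_feasible [Nonempty A] (hC : IsFeatureClass φ C)
    (hΓ : MeasureTheory.AnalyticSet {xa : X × A | xa.2 ∈ Acts xa.1})
    (hK : mixLaw φ p = (mixLaw φ p).fst ⊗ₘ K) {π : Policy Acts} {p0 : Measure X}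
    (hπ : C π ∧ (nr → π.Nonrandomized)) (hp : Induces q π p0 p) :
    IsStrategic q hφ nr p K ∧ ∀ n, p {ω | (ω n).2 ∈ Acts (ω n).1} = 1 := by
  have hmix := isProbabilityMeasure_mixLaw (p := p) hφ
  obtain ⟨m, hm, hmu, hπm⟩ := (hC π).1 hπ.1
  obtain ⟨κ, hκ, hκm⟩ := exists_markovKernel_ae_eq hmu (mixLaw φ p).fst
  have hν : ∀ n, ∀ᵐ h ∂(p.map (hist n)), π.μ n h = κ.comap (φ n) (hφ n) h := fun n =>
    (ae_map_hist_of_ae_fst_mixLaw hφ hκm n).mono fun h hh => (hπm n h).trans hh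
  have hstep := hp.map_hist_succ hν
  have hκK : κ =ᵐ[(mixLaw φ p).fst] K :=
    Kernel.ae_eq_of_compProd_eq ((mixLaw_eq_compProd hφ hstep).symm.trans hK)
  refine ⟨⟨fun n => ?_, fun h => ?_⟩, fun n => ?_⟩
  · have hcongr : p.map (hist n) ⊗ₘ κ.comap (φ n) (hφ n) =
        p.map (hist n) ⊗ₘ K.comap (φ n) (hφ n) :=
      Measure.compProd_congr (ae_map_hist_of_ae_fst_mixLaw hφ hκK n)
    rw [hstep n, stepLaw, stepLaw, hcongr]
  · refine ae_fst_mixLaw hφ (measurableSet_isDirac K.measurable) fun n => ?_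
    filter_upwards [ae_hist_of_ae_fst_mixLaw hφ hκm n, ae_hist_of_ae_fst_mixLaw hφ hκK n]
      with ω h1 h2
    rw [← h2, ← h1, ← hπm]
    exact hπ.2 h n _
  · have hΓu := AnalyticSet.universallyMeasurableSet hΓ
    have hev : Measurable fun ω : Traj X A => ω n := measurable_pi_apply n
    have hp' : IsProbabilityMeasure (p.map fun ω : Traj X A => ω n) :=
      Measure.isProbabilityMeasure_map hev.aemeasurable
    let M := toMeasurable (p.map fun ω => ω n) {xa : X × A | xa.2 ∈ Acts xa.1}
    have hM : MeasurableSet M := measurableSet_toMeasurable _ _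
    have hM' : MeasurableSet {z : Hist X A n × A | (z.1.2, z.2) ∈ M} :=
      (show Measurable fun z : Hist X A n × A => (z.1.2, z.2) by fun_prop) hM
    have hst : Measurable fun ω : Traj X A => (hist n ω, (ω n).2) :=
      (measurable_hist n).prodMk hev.snd
    have h1 : p {ω | (ω n).2 ∈ Acts (ω n).1} = (p.map fun ω => ω n) M := by
      rw [measure_toMeasurable, Measure.map_apply₀ hev.aemeasurable (hΓu _ hp')]
      rfl
    have h2 : (p.map fun ω => ω n) M =
        (p.map fun ω => (hist n ω, (ω n).2)) {z | (z.1.2, z.2) ∈ M} := by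
      rw [Measure.map_apply hev hM, Measure.map_apply hst hM']
      rfl
    rw [h1, h2, map_hist_action (hstep n), ← prob_compl_eq_zero_iff hM', ← mem_ae_iff]
    refine (Measure.ae_compProd_iff hM').2 ((hν n).mono fun h hh => ?_)
    rw [← hh]
    have := π.isProb n h
    have hs : MeasurableSet {a | (h.2, a) ∈ M} := measurable_prodMk_left hM
    refine (prob_compl_eq_zero_iff hs).2 (le_antisymm prob_le_one ?_)
    rw [← π.feasible n h]
    have hsub : {xa : X × A | xa.2 ∈ Acts xa.1} ⊆ M := subset_toMeasurable _ _
    exact measure_mono fun a ha => hsub (show (h.2, a) ∈ {xa : X × A | xa.2 ∈ Acts xa.1} from ha)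

lemma IsFeatureClass.exists_policy (hC : IsFeatureClass φ C)
    {cur : F → X} (hcur : Measurable cur) (hcurφ : ∀ n h, cur (φ n h) = h.2)
    (hne : ∀ x, (Acts x).Nonempty)
    (hΓ : MeasureTheory.AnalyticSet {xa : X × A | xa.2 ∈ Acts xa.1})
    (hK : mixLaw φ p = (mixLaw φ p).fst ⊗ₘ K) (hS : IsStrategic q hφ nr p K)
    (hfeas : ∀ n, p {ω | (ω n).2 ∈ Acts (ω n).1} = 1) :
    ∃ π : Policy Acts, (C π ∧ (nr → π.Nonrandomized)) ∧
      Induces q π (p.map fun ω => (ω 0).1) p := by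
  classical
  have hmix := isProbabilityMeasure_mixLaw (p := p) hφ
  have hΓu := AnalyticSet.universallyMeasurableSet hΓ
  have hev : ∀ n, Measurable fun ω : Traj X A => ω n := fun n => measurable_pi_apply n
  have hp' : ∀ n, IsProbabilityMeasure (p.map fun ω : Traj X A => ω n) := fun n =>
    Measure.isProbabilityMeasure_map (hev n).aemeasurable
  choose G hGsub hGm hGae using fun n => (hΓu _ (hp' n)).exists_measurable_subset_ae_eq
  have hGn : ∀ n, ∀ᵐ ω ∂p, ω n ∈ ⋃ k, G k := fun n => by
    refine (ae_of_ae_map (hev n).aemeasurable ?_ : ∀ᵐ ω ∂p, ω n ∈ G n).mono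
      fun ω hω => Set.mem_iUnion.2 ⟨n, hω⟩
    refine (prob_compl_eq_zero_iff (hGm n)).2 ?_
    rw [measure_congr (hGae n), Measure.map_apply₀ (hev n).aemeasurable (hΓu _ (hp' n))]
    exact hfeas n
  let E : Set (F × A) := {z | (cur z.1, z.2) ∈ ⋃ k, G k}
  have hE : MeasurableSet E :=
    ((hcur.comp measurable_fst).prodMk measurable_snd) (MeasurableSet.iUnion hGm)
  have hEmix : ∀ᵐ z ∂(mixLaw φ p), z ∈ E := ae_mixLaw hφ hE fun n => (hGn n).mono fun ω hω => by
    simp only [E, Set.mem_ofPred_eq, hcurφ]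
    exact hω
  let D : Set F := {f | K f (Prod.mk f ⁻¹' E) = 1} ∩ {f | nr → IsDirac (K f)}
  have hD1 : MeasurableSet {f | K f (Prod.mk f ⁻¹' E) = 1} :=
    (Kernel.measurable_kernel_prodMk_left hE) (measurableSet_singleton 1)
  have hD : MeasurableSet D := by
    refine hD1.inter ?_
    by_cases h : nr
    · simpa [h] using measurableSet_isDirac K.measurable
    · simp [h]
  have hDae : ∀ᵐ f ∂(mixLaw φ p).fst, f ∈ D := by
    refine Filter.Eventually.and ?_ ?_
    · rw [hK] at hEmix
      refine (Measure.ae_ae_of_ae_compProd hEmix).mono fun f hf => ?_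
      exact (prob_compl_eq_zero_iff (measurable_prodMk_left hE)).1 hf
    · by_cases h : nr
      · exact (hS.dirac h).mono fun f hf _ => hf
      · exact Filter.Eventually.of_forall fun f h' => absurd h' h
  obtain ⟨s, hs, hsmem⟩ := exists_universallyMeasurable_selector hne hΓ
  let m : F → Measure A := fun f => if f ∈ D then K f else Measure.dirac (s (cur f))
  have hmprob : ∀ f, IsProbabilityMeasure (m f) := fun f => by
    simp only [m]; split_ifs <;> infer_instance
  have hmu : ∀ B, MeasurableSet B → UniversallyMeasurable fun f => m f B := fun B hB => by
    have h1 : UniversallyMeasurable fun f => K f B := fun V hV =>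
      UniversallyMeasurableSet.of_measurableSet (K.measurable_coe hB hV)
    have h2 : UniversallyMeasurable fun f => Measure.dirac (s (cur f)) B :=
      (hs.comp_measurable hcur).measurable_comp
        ((Measure.measurable_coe hB).comp Measure.measurable_dirac)
    convert h1.ite h2 hD using 2 with f
    simp only [m]; split_ifs <;> rfl
  let π : Policy Acts :=
    { μ := fun n h => m (φ n h)
      isProb := fun n h => hmprob _
      umeas := fun n B hB => (hmu B hB).comp_measurable (hφ n)
      feasible := fun n h => by
        have := hmprob (φ n h)
        refine le_antisymm prob_le_one ?_
        by_cases hf : φ n h ∈ D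
        · simp only [m, hf, if_true]
          rw [← hf.1]
          refine measure_mono fun a ha => ?_
          obtain ⟨k, hk⟩ := Set.mem_iUnion.1 ha
          have := hGsub k hk
          rwa [hcurφ] at this
        · simp only [m, hf, if_false, hcurφ]
          rw [Measure.dirac_apply_of_mem (hsmem _)] }
  refine ⟨π, ⟨(hC π).2 ⟨m, hmprob, hmu, fun _ _ => rfl⟩, fun h n h' => ?_⟩,
    induces_of_stepLaw (fun n => ?_) hS.step⟩
  · by_cases hf : φ n h' ∈ D
    · obtain ⟨a, ha⟩ := hf.2 h
      exact ⟨a, by simp only [π, m, hf, if_true, ha]⟩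
    · exact ⟨s (cur (φ n h')), by simp only [π, m, hf, if_false]⟩
  · refine (ae_map_hist_of_ae_fst_mixLaw hφ hDae n).mono fun h hf => ?_
    simp only [π, m, hf, if_true]
    rfl

lemma IsFeatureClass.mem_SOf_iff [Nonempty A] (hC : IsFeatureClass φ C)
    {cur : F → X} (hcur : Measurable cur) (hcurφ : ∀ n h, cur (φ n h) = h.2)
    (hne : ∀ x, (Acts x).Nonempty)
    (hΓ : MeasureTheory.AnalyticSet {xa : X × A | xa.2 ∈ Acts xa.1})
    {p : ProbabilityMeasure (Traj X A)}
    (hK : mixLaw φ p.toMeasure = (mixLaw φ p.toMeasure).fst ⊗ₘ K) :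
    p ∈ SOf q Acts (fun π => C π ∧ (nr → π.Nonrandomized)) ↔
      IsStrategic q hφ nr p.toMeasure K ∧
        ∀ n, p.toMeasure {ω | (ω n).2 ∈ Acts (ω n).1} = 1 := by
  constructor
  · rintro ⟨π, p0, hπ, hp⟩
    exact hC.isStrategic_and_feasible hΓ hK hπ hp
  · rintro ⟨hS, hfeas⟩
    obtain ⟨π, hπ, hp⟩ := hC.exists_policy hcur hcurφ hne hΓ hK hS hfeas
    have h0 : Measurable fun ω : Traj X A => (ω 0).1 := (measurable_pi_apply 0).fst
    exact ⟨π, p.map h0.aemeasurable, hπ, hp⟩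

end Characterization

section Measurability

variable {T X A F : Type*} [MeasurableSpace T] [MeasurableSpace X] [MeasurableSpace A]
  [MeasurableSpace F] {φ : ∀ n, Hist X A n → F}

/-- The kernel version of `mixLaw`. -/
def mixKernel (φ : ∀ n, Hist X A n → F) (P : Kernel T (Traj X A)) : Kernel T (F × A) :=
  ((Kernel.const T (Measure.count : Measure ℕ).toFinite) ×ₖ P).map
    fun z => (φ z.1 (hist z.1 z.2), (z.2 z.1).2)

lemma mixKernel_apply (hφ : ∀ n, Measurable (φ n)) (P : Kernel T (Traj X A)) [IsMarkovKernel P]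
    (t : T) : mixKernel φ P t = mixLaw φ (P t) := by
  rw [mixKernel, Kernel.map_apply _ (measurable_mixLaw_map hφ), Kernel.prod_apply,
    Kernel.const_apply, mixLaw]

lemma isMarkovKernel_mixKernel (hφ : ∀ n, Measurable (φ n)) (P : Kernel T (Traj X A))
    [IsMarkovKernel P] : IsMarkovKernel (mixKernel φ P) :=
  Kernel.IsMarkovKernel.map _ (measurable_mixLaw_map hφ)

variable [TopologicalSpace A] [PolishSpace A] [BorelSpace A]

lemma exists_disintegration [MeasurableSpace.CountablyGenerated F] [Nonempty A]
    (hφ : ∀ n, Measurable (φ n)) (P : Kernel T (Traj X A)) [IsMarkovKernel P] :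
    ∃ K : Kernel (T × F) A, IsMarkovKernel K ∧
      ∀ t, mixLaw φ (P t) = (mixLaw φ (P t)).fst ⊗ₘ K.sectR t := by
  have := isMarkovKernel_mixKernel hφ P
  refine ⟨(mixKernel φ P).condKernel, inferInstance, fun t => ?_⟩
  have h := congrArg (fun κ => κ t) ((mixKernel φ P).disintegrate (mixKernel φ P).condKernel)
  simp only [Kernel.compProd_apply_eq_compProd_sectR, Kernel.fst_apply,
    mixKernel_apply hφ] at h
  exact h.symm

variable [TopologicalSpace X] [PolishSpace X] [BorelSpace X]

lemma measurableSet_isStrategic (q : Kernel (X × A) X) [IsMarkovKernel q]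
    (hφ : ∀ n, Measurable (φ n)) (nr : Prop) (P : Kernel T (Traj X A)) [IsMarkovKernel P]
    (K : Kernel (T × F) A) [IsMarkovKernel K] :
    MeasurableSet {t | IsStrategic q hφ nr (P t) (K.sectR t)} := by
  have hstep : ∀ n, MeasurableSet {t | (P t).map (hist (n + 1)) =
      stepLaw q ((P t).map (hist n)) ((K.sectR t).comap (φ n) (hφ n))} := fun n => by
    let S : Kernel T (Hist X A (n + 1)) :=
      (((P.map (hist n)) ⊗ₖ K.comap (Prod.map id (φ n)) (measurable_id.prodMap (hφ n))) ⊗ₖ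
        (nextState q n).comap Prod.snd measurable_snd).map fun z => extend z.1.1 z.1.2 z.2
    have : IsMarkovKernel (P.map (hist n)) := Kernel.IsMarkovKernel.map _ (measurable_hist n)
    have : IsMarkovKernel (P.map (hist (n + 1))) :=
      Kernel.IsMarkovKernel.map _ (measurable_hist (n + 1))
    have : IsMarkovKernel S := Kernel.IsMarkovKernel.map _ (measurable_extend n)
    have hS : ∀ t, S t = stepLaw q ((P t).map (hist n)) ((K.sectR t).comap (φ n) (hφ n)) := by
      intro t
      rw [Kernel.map_apply _ (measurable_extend n), Kernel.compProd_apply_eq_compProd_sectR,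
        Kernel.compProd_apply_eq_compProd_sectR, Kernel.map_apply _ (measurable_hist n)]
      rfl
    simp only [← hS, ← Kernel.map_apply P (measurable_hist (n + 1))]
    exact measurableSet_setOf_measure_eq (P.map (hist (n + 1))).measurable S.measurable
  have hdirac : MeasurableSet {t | ∀ᵐ f ∂(mixLaw φ (P t)).fst, IsDirac (K.sectR t f)} := by
    have := isMarkovKernel_mixKernel hφ P
    have hD : MeasurableSet {z : T × F | IsDirac (K z)} := measurableSet_isDirac K.measurable
    have : {t | ∀ᵐ f ∂(mixLaw φ (P t)).fst, IsDirac (K.sectR t f)} =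
        {t | (mixKernel φ P).fst t (Prod.mk t ⁻¹' {z : T × F | IsDirac (K z)}ᶜ) = 0} := by
      ext t
      simp only [Set.mem_ofPred_eq, Kernel.fst_apply, mixKernel_apply hφ, ae_iff]
      rfl
    rw [this]
    exact (Kernel.measurable_kernel_prodMk_left hD.compl) (measurableSet_singleton 0)
  have : {t | IsStrategic q hφ nr (P t) (K.sectR t)} =
      (⋂ n, {t | (P t).map (hist (n + 1)) =
        stepLaw q ((P t).map (hist n)) ((K.sectR t).comap (φ n) (hφ n))}) ∩
      {t | nr → ∀ᵐ f ∂(mixLaw φ (P t)).fst, IsDirac (K.sectR t f)} := by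
    ext t
    simp only [Set.mem_ofPred_eq, Set.mem_inter_iff, Set.mem_iInter]
    exact ⟨fun h => ⟨h.step, h.dirac⟩, fun h => ⟨h.1, h.2⟩⟩
  rw [this]
  refine (MeasurableSet.iInter hstep).inter ?_
  by_cases h : nr
  · simpa [h] using hdirac
  · simp [h]

end Measurability

lemma IsFeatureClass.analyticSet_and_measurableSet {X A F : Type*} [TopologicalSpace X]
    [PolishSpace X] [MeasurableSpace X] [BorelSpace X]
    [TopologicalSpace A] [PolishSpace A] [MeasurableSpace A] [BorelSpace A] [Nonempty A]
    [MeasurableSpace F] [MeasurableSpace.CountablyGenerated F]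
    {q : Kernel (X × A) X} [IsMarkovKernel q] {Acts : X → Set A}
    {φ : ∀ n, Hist X A n → F} {C : Policy Acts → Prop}
    (hC : IsFeatureClass φ C) (hφ : ∀ n, Measurable (φ n))
    {cur : F → X} (hcur : Measurable cur) (hcurφ : ∀ n h, cur (φ n h) = h.2)
    (hne : ∀ x, (Acts x).Nonempty)
    (hΓ : MeasureTheory.AnalyticSet {xa : X × A | xa.2 ∈ Acts xa.1}) (nr : Prop) :
    MeasureTheory.AnalyticSet (tset q Acts fun π => C π ∧ (nr → π.Nonrandomized)) ∧
    (MeasurableSet {xa : X × A | xa.2 ∈ Acts xa.1} →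
      MeasurableSet (tset q Acts fun π => C π ∧ (nr → π.Nonrandomized))) := by
  have hmeas := measurable_probabilityMeasure_toMeasure (Ω := Traj X A)
  let P : Kernel (X × ProbabilityMeasure (Traj X A)) (Traj X A) :=
    ⟨fun xp => xp.2.toMeasure, hmeas.comp measurable_snd⟩
  have hP : IsMarkovKernel P := ⟨fun xp => show IsProbabilityMeasure xp.2.toMeasure from inferInstance⟩
  obtain ⟨K, hKm, hK⟩ := exists_disintegration hφ P
  have h0 : Measurable fun ω : Traj X A => (ω 0).1 := (measurable_pi_apply 0).fst
  have hinit : MeasurableSet {xp : X × ProbabilityMeasure (Traj X A) |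
      xp.2.toMeasure.map (fun ω => (ω 0).1) = Measure.dirac xp.1} := by
    have : IsMarkovKernel (P.map fun ω => (ω 0).1) := Kernel.IsMarkovKernel.map _ h0
    have h := measurableSet_setOf_measure_eq (P.map fun ω => (ω 0).1).measurable
      (η := fun xp : X × ProbabilityMeasure (Traj X A) => Measure.dirac xp.1)
      (Measure.measurable_dirac.comp measurable_fst)
    simp only [Kernel.map_apply P h0] at h
    exact h
  have heq : tset q Acts (fun π => C π ∧ (nr → π.Nonrandomized)) =
      ({xp | IsStrategic q hφ nr (P xp) (K.sectR xp)} ∩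
        {xp | xp.2.toMeasure.map (fun ω => (ω 0).1) = Measure.dirac xp.1}) ∩
      ⋂ n, Prod.snd ⁻¹' {p : ProbabilityMeasure (Traj X A) |
        p.toMeasure ((fun ω => ω n) ⁻¹' {xa : X × A | xa.2 ∈ Acts xa.1}) = 1} := by
    ext xp
    have := hC.mem_SOf_iff (q := q) (hφ := hφ) (nr := nr) hcur hcurφ hne hΓ (hK xp)
    simp only [tset, tsec, Set.mem_ofPred_eq, this, Set.mem_inter_iff, Set.mem_iInter,
      Set.mem_preimage]
    exact and_right_comm
  have hB := (measurableSet_isStrategic q hφ nr P K).inter hinit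
  rw [heq]
  refine ⟨?_, fun hΓm => ?_⟩
  · rw [Set.inter_iInter]
    refine MeasureTheory.AnalyticSet.iInter fun n => ?_
    rw [Set.inter_eq_iInter]
    refine MeasureTheory.AnalyticSet.iInter fun b => ?_
    cases b
    · exact AnalyticSet.preimage_snd_probabilityMeasure
        (analyticSet_setOf_measure_eq_one (hΓ.preimage (continuous_apply n)))
    · exact analyticSet_of_measurableSet_prod_probabilityMeasure hB
  · refine hB.inter (MeasurableSet.iInter fun n => measurable_snd ?_)
    exact measurable_measureOn (measurable_pi_apply n hΓm) (measurableSet_singleton 1)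

section Classes

variable {X A : Type*} [MeasurableSpace X] [MeasurableSpace A] {Acts : X → Set A}

lemma Policy.universallyMeasurable_uncurry (π : Policy Acts) {B : Set A} (hB : MeasurableSet B) :
    UniversallyMeasurable fun f : ℕ × Traj X A × X =>
      π.μ f.1 (fun i => f.2.1 i, f.2.2) B := by
  intro s hs
  have : (fun f : ℕ × Traj X A × X => π.μ f.1 (fun i => f.2.1 i, f.2.2) B) ⁻¹' s =
      ⋃ k, Prod.fst ⁻¹' {k} ∩ (fun f : ℕ × Traj X A × X =>
        ((fun i : Fin k => f.2.1 i, f.2.2) : Hist X A k)) ⁻¹' ((fun h => π.μ k h B) ⁻¹' s) := by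
    ext f
    simp
  rw [this]
  have hmeas : ∀ k, Measurable fun f : ℕ × Traj X A × X =>
      ((fun i : Fin k => f.2.1 i, f.2.2) : Hist X A k) := fun k => by fun_prop
  exact fun μ hμ => .iUnion fun k =>
    (measurable_fst (measurableSet_singleton k)).nullMeasurableSet.inter
      ((π.umeas k B hB s hs).preimage (hmeas k) μ hμ)

/-- The stage, the past padded by `c`, and the current state. -/
def pastFeature (c : X × A) (n : ℕ) (h : Hist X A n) : ℕ × Traj X A × X :=
  (n, fun i => if hi : i < n then h.1 ⟨i, hi⟩ else c, h.2)

lemma measurable_pastFeature (c : X × A) (n : ℕ) : Measurable (pastFeature c n) := by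
  refine measurable_const.prodMk ((measurable_pi_lambda _ fun i => ?_).prodMk measurable_snd)
  by_cases hi : i < n
  · simp only [hi, dite_true]
    fun_prop
  · simp only [hi, dite_false]
    exact measurable_const

lemma isFeatureClass_all (c : X × A) :
    IsFeatureClass (Acts := Acts) (pastFeature c) fun _ => True := by
  refine fun π => ⟨fun _ => ⟨fun f => π.μ f.1 (fun i => f.2.1 i, f.2.2), fun f => π.isProb _ _,
    fun B hB => π.universallyMeasurable_uncurry hB, fun n h => ?_⟩, fun _ => trivial⟩
  simp [pastFeature]

lemma isFeatureClass_markov (c : X × A) :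
    IsFeatureClass (Acts := Acts) (fun n h => (n, h.2)) Policy.Markov := by
  refine fun π => ⟨fun ⟨m, hm⟩ => ⟨fun f => π.μ f.1 (fun _ => c, f.2), fun f => π.isProb _ _,
    fun B hB => ?_, fun n h => ?_⟩, fun ⟨m, _, _, hm⟩ => ⟨fun n x => m (n, x), hm⟩⟩
  · exact (π.universallyMeasurable_uncurry hB).comp_measurable
      (f := fun f : ℕ × X => (f.1, fun _ => c, f.2)) (by fun_prop)
  · exact (hm n h).trans (hm n (fun _ => c, h.2)).symm

lemma isFeatureClass_stationary (c : X × A) :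
    IsFeatureClass (Acts := Acts) (fun _ h => h.2) Policy.Stationary := by
  refine fun π => ⟨fun ⟨m, hm⟩ => ⟨fun x => π.μ 0 (fun _ => c, x), fun f => π.isProb _ _,
    fun B hB => ?_, fun n h => ?_⟩, fun ⟨m, _, _, hm⟩ => ⟨m, hm⟩⟩
  · exact UniversallyMeasurable.comp_measurable (π.umeas 0 B hB)
      (f := fun x : X => ((fun _ => c, x) : Hist X A 0)) (by fun_prop)
  · exact (hm n h).trans (hm 0 (fun _ => c, h.2)).symm

end Classes

/-- Lemma `lem-ext-set`: for each `S_⋆ ∈ {S, S_m, S_s}`, the sets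
`tilde-S_⋆` and `tilde-S'_⋆` are analytic subsets of `𝕏 × P(Ω)`; if `Γ` is Borel they
are Borel. -/
theorem statement1
    {X A : Type*} [TopologicalSpace X] [PolishSpace X] [MeasurableSpace X] [BorelSpace X]
    [TopologicalSpace A] [PolishSpace A] [MeasurableSpace A] [BorelSpace A]
    (q : Kernel (X × A) X) [IsMarkovKernel q] (Acts : X → Set A)
    (hne : ∀ x, (Acts x).Nonempty)
    (hΓ : MeasureTheory.AnalyticSet {xa : X × A | xa.2 ∈ Acts xa.1}) :
    (MeasureTheory.AnalyticSet (tset q Acts fun _ => True) ∧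
     MeasureTheory.AnalyticSet (tset q Acts Policy.Nonrandomized) ∧
     MeasureTheory.AnalyticSet (tset q Acts Policy.Markov) ∧
     MeasureTheory.AnalyticSet (tset q Acts fun π => π.Markov ∧ π.Nonrandomized) ∧
     MeasureTheory.AnalyticSet (tset q Acts Policy.Stationary) ∧
     MeasureTheory.AnalyticSet (tset q Acts fun π => π.Stationary ∧ π.Nonrandomized)) ∧
    (MeasurableSet {xa : X × A | xa.2 ∈ Acts xa.1} →
     MeasurableSet (tset q Acts fun _ => True) ∧
     MeasurableSet (tset q Acts Policy.Nonrandomized) ∧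
     MeasurableSet (tset q Acts Policy.Markov) ∧
     MeasurableSet (tset q Acts fun π => π.Markov ∧ π.Nonrandomized) ∧
     MeasurableSet (tset q Acts Policy.Stationary) ∧
     MeasurableSet (tset q Acts fun π => π.Stationary ∧ π.Nonrandomized)) := by
  rcases isEmpty_or_nonempty X with hX | ⟨⟨x⟩⟩
  · simp only [Set.eq_empty_of_isEmpty (tset q Acts _)]
    simp [MeasureTheory.analyticSet_empty]
  obtain ⟨a, -⟩ := hne x
  have : Nonempty A := ⟨a⟩
  have hS := (isFeatureClass_all (Acts := Acts) (x, a)).analyticSet_and_measurableSet (q := q)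
    (measurable_pastFeature _) (cur := fun f => f.2.2) (by fun_prop) (fun _ _ => rfl) hne hΓ
  have hM := (isFeatureClass_markov (Acts := Acts) (x, a)).analyticSet_and_measurableSet (q := q)
    (fun n => by fun_prop) (cur := Prod.snd) measurable_snd (fun _ _ => rfl) hne hΓ
  have hT := (isFeatureClass_stationary (Acts := Acts) (x, a)).analyticSet_and_measurableSet
    (q := q) (fun n => measurable_snd) measurable_id (fun _ _ => rfl) hne hΓ
  have hS0 := hS False
  have hS1 := hS True
  have hM0 := hM False
  have hM1 := hM True
  have hT0 := hT False
  have hT1 := hT True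
  simp only [false_imp_iff, true_imp_iff, and_true, true_and] at hS0 hS1 hM0 hM1 hT0 hT1
  exact ⟨⟨hS0.1, hS1.1, hM0.1, hM1.1, hT0.1, hT1.1⟩, fun h =>
    ⟨hS0.2 h, hS1.2 h, hM0.2 h, hM1.2 h, hT0.2 h, hT1.2 h⟩⟩

end PaperStmt
end
end
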